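/- There exists a positive absolute constant λ such that the following holds for every δ > 0. Let f : ℕ → [0,1] be a multiplicative function and suppose that ∑_{X^δ < p ≤ X^{1/4}} f(p)/p ≥ λ (sum over primes). Then there is a constant c > 0 depending only on δ such that for all X sufficiently large (in terms of δ): (1/X) ∑_{X < n ≤ 2X} f(n) ≥ c · ∏_{p ≤ X} (1 + (f(p) − 1)/p), the product running over primes p ≤ X. -/

import Mathlib

section

open Real Finset

/-- The Fourier transform on `[0, 1]` of the Beurling–Selberg type minorant `selbergKernel`. -/
noncomputable def selbergHat (t : ℝ) : ℝ := (1 - t) + sin (2 * π * t) / (2 * π)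

/-- A band-limited function which is nonpositive outside `[-(2 * π), 2 * π]` and has positive integral. -/
noncomputable def selbergKernel (x : ℝ) : ℝ := 2 * ∫ t in (0 : ℝ)..1, selbergHat t * cos (t * x)

lemma continuous_selbergHat : Continuous selbergHat := by
  unfold selbergHat; fun_prop

lemma abs_selbergHat_le {t : ℝ} (h0 : 0 ≤ t) (h1 : t ≤ 1) : |selbergHat t| ≤ 2 := by
  unfold selbergHat
  have h2 : |sin (2 * π * t) / (2 * π)| ≤ 1 := by
    rw [abs_div, abs_of_pos two_pi_pos, div_le_one two_pi_pos]
    linarith [abs_sin_le_one (2 * π * t), pi_gt_three]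
  have h3 : |1 - t| ≤ 1 := by rw [abs_le]; constructor <;> linarith
  linarith [abs_add_le (1 - t) (sin (2 * π * t) / (2 * π))]

lemma abs_selbergKernel_le (x : ℝ) : |selbergKernel x| ≤ 4 := by
  unfold selbergKernel
  have h : ‖∫ t in (0 : ℝ)..1, selbergHat t * cos (t * x)‖ ≤ 2 * |(1 : ℝ) - 0| := by
    apply intervalIntegral.norm_integral_le_of_norm_le_const
    intro t ht
    rw [Set.uIoc_of_le zero_le_one] at ht
    rw [norm_mul, norm_eq_abs, norm_eq_abs]
    nlinarith [abs_selbergHat_le ht.1.le ht.2, abs_cos_le_one (t * x), abs_nonneg (selbergHat t),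
      abs_nonneg (cos (t * x))]
  rw [norm_eq_abs] at h
  rw [abs_mul, abs_two]
  norm_num at h
  linarith

lemma selbergKernel_neg (x : ℝ) : selbergKernel (-x) = selbergKernel x := by
  simp [selbergKernel]

lemma continuous_selbergKernel : Continuous selbergKernel := by
  unfold selbergKernel
  have := continuous_selbergHat
  refine continuous_const.mul ?_
  apply intervalIntegral.continuous_parametric_intervalIntegral_of_continuous'
  fun_prop

lemma selbergKernel_eq {x : ℝ} (h0 : x ≠ 0) (h1 : 2 * π - x ≠ 0) (h2 : 2 * π + x ≠ 0) :
    selbergKernel x = 2 * (1 - cos x) * (1 / x ^ 2 + 1 / ((2 * π - x) * (2 * π + x))) := by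
  have hd : ∀ t ∈ Set.uIcc (0 : ℝ) 1, HasDerivAt (fun t => (1 - t) * sin (t * x) / x
      - cos (t * x) / x ^ 2 - (cos ((2 * π + x) * t) / (2 * π + x)
        + cos ((2 * π - x) * t) / (2 * π - x)) / (4 * π)) (selbergHat t * cos (t * x)) t := by
    intro t _
    have e1 : HasDerivAt (fun t : ℝ => t * x) x t := by simpa using (hasDerivAt_id t).mul_const x
    have e2 : HasDerivAt (fun t : ℝ => (2 * π + x) * t) (2 * π + x) t := by
      simpa using (hasDerivAt_id t).const_mul (2 * π + x)
    have e3 : HasDerivAt (fun t : ℝ => (2 * π - x) * t) (2 * π - x) t := by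
      simpa using (hasDerivAt_id t).const_mul (2 * π - x)
    have e4 : HasDerivAt (fun t : ℝ => 1 - t) (-1) t := by
      simpa using (hasDerivAt_id t).const_sub 1
    have := ((((e4.mul e1.sin).div_const x).sub (e1.cos.div_const (x ^ 2))).sub
      (((e2.cos.div_const (2 * π + x)).add (e3.cos.div_const (2 * π - x))).div_const (4 * π)))
    refine this.congr_deriv ?_
    unfold selbergHat
    have a1 : (2 * π + x) * t = 2 * π * t + t * x := by ring
    have a2 : (2 * π - x) * t = 2 * π * t - t * x := by ring
    rw [a1, a2, sin_add, sin_sub]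
    have := pi_ne_zero
    field_simp
    ring
  have hi := intervalIntegral.integral_eq_sub_of_hasDerivAt hd
    ((continuous_selbergHat.mul (by fun_prop)).intervalIntegrable _ _)
  rw [selbergKernel, hi]
  have c1 : cos ((2 * π + x) * 1) = cos x := by rw [mul_one, add_comm, cos_add_two_pi]
  have c2 : cos ((2 * π - x) * 1) = cos x := by rw [mul_one, cos_two_pi_sub]
  rw [c1, c2]
  have := pi_ne_zero
  simp
  field_simp
  ring

lemma one_div_sq_add {x M : ℝ} (h0 : x ≠ 0) (h1 : M - x ≠ 0) (h2 : M + x ≠ 0) :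
    1 / x ^ 2 + 1 / ((M - x) * (M + x)) = M ^ 2 / (x ^ 2 * ((M - x) * (M + x))) := by
  field_simp; ring

lemma selbergKernel_nonpos {x : ℝ} (hx : 2 * π < |x|) : selbergKernel x ≤ 0 := by
  wlog h : 0 ≤ x generalizing x
  · rw [← selbergKernel_neg]; exact this (by rwa [abs_neg]) (by linarith)
  rw [abs_of_nonneg h] at hx
  have hp := pi_pos
  have h1 : 2 * π - x < 0 := by linarith
  have h2 : 0 < 2 * π + x := by linarith
  have h0 : 0 < x := by linarith
  rw [selbergKernel_eq h0.ne' h1.ne h2.ne', one_div_sq_add h0.ne' h1.ne h2.ne']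
  apply mul_nonpos_of_nonneg_of_nonpos
  · linarith [cos_le_one x]
  · apply div_nonpos_of_nonneg_of_nonpos (by positivity)
    exact mul_nonpos_of_nonneg_of_nonpos (by positivity) (mul_nonpos_of_nonpos_of_nonneg h1.le h2.le)

lemma one_sub_cos_le_self {w : ℝ} (hw : 0 ≤ w) : 1 - cos w ≤ w := by
  have h1 := one_sub_sq_div_two_le_cos (x := w)
  have h2 := neg_one_le_cos w
  rcases le_total w 2 with h | h <;> nlinarith

lemma selbergKernel_ge_of_gt {x : ℝ} (hx : 2 * π < x) : -(2 * π) * x ^ (-2 : ℤ) ≤ selbergKernel x := by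
  have hp := pi_pos
  have h1 : 2 * π - x < 0 := by linarith
  have h2 : 0 < 2 * π + x := by linarith
  have h0 : 0 < x := by linarith
  rw [selbergKernel_eq h0.ne' h1.ne h2.ne', one_div_sq_add h0.ne' h1.ne h2.ne']
  have hc : 1 - cos x ≤ x - 2 * π := by
    have := one_sub_cos_le_self (w := x - 2 * π) (by linarith)
    rwa [cos_sub_two_pi] at this
  have hw : 0 < x - 2 * π := by linarith
  have e : 2 * (1 - cos x) * ((2 * π) ^ 2 / (x ^ 2 * ((2 * π - x) * (2 * π + x)))) =
      -(2 * ((1 - cos x) / (x - 2 * π)) * ((2 * π) ^ 2 / (2 * π + x)) * (x ^ 2)⁻¹) := by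
    have : (2 * π - x) = - (x - 2 * π) := by ring
    rw [this]; field_simp
  rw [e]
  have h3 : (1 - cos x) / (x - 2 * π) ≤ 1 := by rwa [div_le_one hw]
  have h4 : (2 * π) ^ 2 / (2 * π + x) ≤ π := by
    rw [div_le_iff₀ h2]; nlinarith
  have h5 : 0 ≤ (2 * π) ^ 2 / (2 * π + x) := by positivity
  have h7 : 2 * ((1 - cos x) / (x - 2 * π)) * ((2 * π) ^ 2 / (2 * π + x)) ≤ 2 * π := by nlinarith
  have h6 : 0 ≤ (x ^ 2)⁻¹ := by positivity
  have h8 : x ^ (-2 : ℤ) = (x ^ 2)⁻¹ := by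
    rw [zpow_neg]; norm_cast
  rw [h8]
  nlinarith

lemma selbergKernel_nonneg_of_lt {x : ℝ} (h0 : 0 < x) (hx : x < 2 * π) : 0 ≤ selbergKernel x := by
  have h1 : 0 < 2 * π - x := by linarith
  have h2 : 0 < 2 * π + x := by linarith
  rw [selbergKernel_eq h0.ne' h1.ne' h2.ne']
  have := cos_le_one x
  have : 0 ≤ 1 - cos x := by linarith
  positivity

lemma selbergKernel_ge_of_lt_pi {x : ℝ} (h0 : 0 < x) (hx : x < π) :
    4 / π ^ 2 ≤ selbergKernel x := by
  have hp := pi_pos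
  have h1 : 0 < 2 * π - x := by linarith
  have h2 : 0 < 2 * π + x := by linarith
  rw [selbergKernel_eq h0.ne' h1.ne' h2.ne']
  have h3 : cos x ≤ 1 - 2 / π ^ 2 * x ^ 2 := cos_le_one_sub_mul_cos_sq (by rw [abs_of_pos h0]; exact hx.le)
  have h4 : 0 < 1 / ((2 * π - x) * (2 * π + x)) := by positivity
  have h5 : 0 ≤ 1 - cos x := by linarith [cos_le_one x]
  have h6 : 4 / π ^ 2 = 2 * (2 / π ^ 2 * x ^ 2) * (1 / x ^ 2) := by field_simp; norm_num
  rw [h6]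
  have h7 : 0 < 1 / x ^ 2 := by positivity
  have h8 : 0 ≤ 2 / π ^ 2 * x ^ 2 := by positivity
  calc _ ≤ 2 * (1 - cos x) * (1 / x ^ 2) := by gcongr; linarith
    _ ≤ _ := by gcongr; linarith

lemma integral_selbergKernel_ge_half {v : ℝ} (hv : 2 * π ≤ v) :
    1 / 5 ≤ ∫ x in (0 : ℝ)..v, selbergKernel x := by
  have hp := pi_pos
  have ii : ∀ a b, IntervalIntegrable selbergKernel MeasureTheory.volume a b :=
    fun a b => continuous_selbergKernel.intervalIntegrable a b
  rw [← intervalIntegral.integral_add_adjacent_intervals (ii 0 π) (ii π v),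
    ← intervalIntegral.integral_add_adjacent_intervals (ii π (2 * π)) (ii (2 * π) v)]
  have h1 : 4 / π ≤ ∫ x in (0 : ℝ)..π, selbergKernel x := by
    have : ∫ x in (0 : ℝ)..π, 4 / π ^ 2 = 4 / π := by
      rw [intervalIntegral.integral_const, smul_eq_mul]; field_simp; ring
    rw [← this]
    exact intervalIntegral.integral_mono_on_of_le_Ioo hp.le (by simp) (ii _ _)
      fun x hx => selbergKernel_ge_of_lt_pi hx.1 hx.2
  have h2 : 0 ≤ ∫ x in π..(2 * π), selbergKernel x := by
    have := intervalIntegral.integral_mono_on_of_le_Ioo (a := π) (b := 2 * π) (by linarith)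
      (f := fun _ => (0 : ℝ)) (by simp) (ii _ _)
      fun x hx => selbergKernel_nonneg_of_lt (hp.trans hx.1) hx.2
    simpa using this
  have h3 : -1 ≤ ∫ x in (2 * π)..v, selbergKernel x := by
    have hn : (0 : ℝ) ∉ Set.uIcc (2 * π) v := by
      rw [Set.uIcc_of_le hv]; intro h; linarith [h.1]
    have hi : IntervalIntegrable (fun x : ℝ => x ^ (-2 : ℤ)) MeasureTheory.volume (2 * π) v :=
      intervalIntegral.intervalIntegrable_zpow (Or.inr hn)
    have := intervalIntegral.integral_mono_on_of_le_Ioo (a := 2 * π) (b := v) hv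
      (f := fun x => -(2 * π) * x ^ (-2 : ℤ)) (hi.const_mul _) (ii _ _)
      fun x hx => selbergKernel_ge_of_gt hx.1
    refine le_trans ?_ this
    rw [intervalIntegral.integral_const_mul, integral_zpow (Or.inr ⟨by norm_num, hn⟩)]
    norm_num
    have : 0 < v⁻¹ := inv_pos.2 (by linarith)
    have e : 2 * π * (π⁻¹ * (1 / 2)) = 1 := by field_simp
    nlinarith
  have h4 : (6 : ℝ) / 5 ≤ 4 / π := by
    rw [div_le_div_iff₀ (by norm_num) hp]; linarith [pi_lt_d2]
  linarith

lemma integral_selbergKernel_ge {u v : ℝ} (hu : u ≤ -(2 * π)) (hv : 2 * π ≤ v) :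
    2 / 5 ≤ ∫ x in u..v, selbergKernel x := by
  have ii : ∀ a b, IntervalIntegrable selbergKernel MeasureTheory.volume a b :=
    fun a b => continuous_selbergKernel.intervalIntegrable a b
  rw [← intervalIntegral.integral_add_adjacent_intervals (ii u 0) (ii 0 v)]
  have h1 := integral_selbergKernel_ge_half hv
  have h2 := integral_selbergKernel_ge_half (v := -u) (by linarith)
  have h3 := intervalIntegral.integral_comp_neg (a := u) (b := 0) selbergKernel
  simp only [selbergKernel_neg, neg_zero] at h3
  rw [h3]
  linarith

/-- The exponential sum with weights `w` and frequencies `x` over `P`. -/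
noncomputable def expSum (P : Finset ℕ) (w x : ℕ → ℝ) (t : ℝ) : ℂ :=
  ∑ p ∈ P, (w p : ℂ) * Complex.exp ((t * x p : ℝ) * Complex.I)

/-- The number of `k`-tuples from `P`, weighted by `w`, whose `x`-sum lies near `τ` as measured by
`selbergKernel`. -/
noncomputable def smoothCount (P : Finset ℕ) (w x : ℕ → ℝ) (k : ℕ) (τ : ℝ) : ℝ :=
  ∑ q ∈ Fintype.piFinset (fun _ : Fin k => P),
    (∏ i, w (q i)) * selbergKernel (∑ i, x (q i) - τ)

lemma continuous_expSum (P : Finset ℕ) (w x : ℕ → ℝ) : Continuous (expSum P w x) := by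
  unfold expSum; fun_prop

lemma re_expSum_pow_mul (P : Finset ℕ) (w x : ℕ → ℝ) (k : ℕ) (t τ : ℝ) :
    (expSum P w x t ^ k * Complex.exp ((-(t * τ) : ℝ) * Complex.I)).re =
      ∑ q ∈ Fintype.piFinset (fun _ : Fin k => P),
        (∏ i, w (q i)) * cos (t * (∑ i, x (q i) - τ)) := by
  have h : expSum P w x t ^ k = ∑ q ∈ Fintype.piFinset (fun _ : Fin k => P),
      ((∏ i, w (q i) : ℝ) : ℂ) * Complex.exp ((t * ∑ i, x (q i) : ℝ) * Complex.I) := by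
    rw [expSum, Finset.sum_pow']
    refine Finset.sum_congr rfl fun q _ => ?_
    rw [Finset.prod_mul_distrib, ← Complex.exp_sum]
    push_cast
    rw [Finset.mul_sum, Finset.sum_mul]
  rw [h, Finset.sum_mul, Complex.re_sum]
  refine Finset.sum_congr rfl fun q _ => ?_
  rw [mul_assoc, ← Complex.exp_add, Complex.re_ofReal_mul, ← add_mul, ← Complex.ofReal_add,
    Complex.exp_ofReal_mul_I_re]
  congr 2
  ring

lemma smoothCount_eq_integral (P : Finset ℕ) (w x : ℕ → ℝ) (k : ℕ) (τ : ℝ) :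
    smoothCount P w x k τ = 2 * ∫ t in (0 : ℝ)..1, selbergHat t *
      (expSum P w x t ^ k * Complex.exp ((-(t * τ) : ℝ) * Complex.I)).re := by
  simp_rw [re_expSum_pow_mul, Finset.mul_sum]
  rw [intervalIntegral.integral_finsetSum]
  · rw [smoothCount, Finset.mul_sum]
    refine Finset.sum_congr rfl fun q _ => ?_
    simp_rw [mul_left_comm (selbergHat _)]
    rw [intervalIntegral.integral_const_mul, selbergKernel]
    ring
  · intro q _
    have := continuous_selbergHat
    apply Continuous.intervalIntegrable
    fun_prop

lemma two_mul_smoothCount_sub_le (P : Finset ℕ) (w x : ℕ → ℝ) (k : ℕ) (τ s : ℝ) :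
    2 * smoothCount P w x k τ - smoothCount P w x k (τ + s) - smoothCount P w x k (τ - s) ≤
      8 * ∫ t in (0 : ℝ)..1, ‖expSum P w x t‖ ^ k * (1 - cos (t * s)) := by
  have hE := continuous_expSum P w x
  have hH := continuous_selbergHat
  have hc : ∀ σ : ℝ, IntervalIntegrable (fun t => selbergHat t *
      (expSum P w x t ^ k * Complex.exp ((-(t * σ) : ℝ) * Complex.I)).re)
      MeasureTheory.volume 0 1 := by
    intro σ
    apply Continuous.intervalIntegrable
    refine hH.mul (Complex.continuous_re.comp ?_)
    fun_prop
  have e : 2 * smoothCount P w x k τ - smoothCount P w x k (τ + s) - smoothCount P w x k (τ - s) =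
      4 * ∫ t in (0 : ℝ)..1, (selbergHat t *
      (expSum P w x t ^ k * Complex.exp ((-(t * τ) : ℝ) * Complex.I)).re) * (1 - cos (t * s)) := by
    simp_rw [smoothCount_eq_integral]
    rw [← intervalIntegral.integral_const_mul, ← intervalIntegral.integral_const_mul,
      ← intervalIntegral.integral_const_mul, ← intervalIntegral.integral_const_mul,
      ← intervalIntegral.integral_const_mul, ← intervalIntegral.integral_sub,
      ← intervalIntegral.integral_sub]
    · congr 1
      ext t
      simp_rw [re_expSum_pow_mul, Finset.mul_sum, Finset.sum_mul, Finset.mul_sum]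
      rw [← Finset.sum_sub_distrib, ← Finset.sum_sub_distrib]
      refine Finset.sum_congr rfl fun q _ => ?_
      have e1 : t * (∑ i, x (q i) - (τ + s)) = t * (∑ i, x (q i) - τ) - t * s := by ring
      have e2 : t * (∑ i, x (q i) - (τ - s)) = t * (∑ i, x (q i) - τ) + t * s := by ring
      rw [e1, e2, cos_add, cos_sub]
      ring
    · exact (((hc τ).const_mul _).const_mul _).sub ((hc _).const_mul _)
    · exact (hc _).const_mul _
    · exact ((hc _).const_mul _).const_mul _
    · exact (hc _).const_mul _
  rw [e]
  have : ∫ t in (0 : ℝ)..1, (selbergHat t *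
      (expSum P w x t ^ k * Complex.exp ((-(t * τ) : ℝ) * Complex.I)).re) * (1 - cos (t * s)) ≤
      ∫ t in (0 : ℝ)..1, 2 * (‖expSum P w x t‖ ^ k * (1 - cos (t * s))) := by
    apply intervalIntegral.integral_mono_on zero_le_one
    · exact (hc τ).mul_continuousOn (by fun_prop)
    · apply Continuous.intervalIntegrable; fun_prop
    · intro t ht
      rw [← mul_assoc]
      apply mul_le_mul_of_nonneg_right _ (by linarith [cos_le_one (t * s)])
      refine (le_abs_self _).trans ?_
      rw [abs_mul]
      apply mul_le_mul (abs_selbergHat_le ht.1 ht.2) _ (abs_nonneg _) (by norm_num)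
      refine (Complex.abs_re_le_norm _).trans ?_
      rw [norm_mul, Complex.norm_exp_ofReal_mul_I, mul_one, norm_pow]
  rw [intervalIntegral.integral_const_mul] at this
  linarith

/-- A point distribution on `[Y, 2 * Y]` with no concentration on intervals of length at least `h₀`. -/
structure SpreadOut (P : Finset ℕ) (w x : ℕ → ℝ) (Y C h₀ : ℝ) : Prop where
  nonneg : ∀ p ∈ P, 0 ≤ w p
  ge : ∀ p ∈ P, Y ≤ x p
  le : ∀ p ∈ P, x p ≤ 2 * Y
  mass : ∀ u h : ℝ, h₀ ≤ h → ∑ p ∈ P with u ≤ x p ∧ x p ≤ u + h, w p ≤ C * (√h + h) / Y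

lemma norm_expSum_eq (P : Finset ℕ) (w x : ℕ → ℝ) (t : ℝ) :
    ∃ θ : ℝ, ‖expSum P w x t‖ = ∑ p ∈ P, w p * cos (t * x p - θ) := by
  refine ⟨(expSum P w x t).arg, ?_⟩
  set z := expSum P w x t with hz
  have h1 : (‖z‖ : ℂ) = z * Complex.exp ((-z.arg : ℝ) * Complex.I) := by
    have := Complex.norm_mul_exp_arg_mul_I z
    calc (‖z‖ : ℂ) = ‖z‖ * Complex.exp (z.arg * Complex.I) *
        Complex.exp ((-z.arg : ℝ) * Complex.I) := by
          rw [mul_assoc, ← Complex.exp_add]; simp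
      _ = _ := by rw [this]
  have h2 : ‖z‖ = (z * Complex.exp ((-z.arg : ℝ) * Complex.I)).re := by rw [← h1]; simp
  rw [h2]
  conv_lhs => rw [hz]
  rw [expSum, Finset.sum_mul, Complex.re_sum]
  refine Finset.sum_congr rfl fun q _ => ?_
  rw [mul_assoc, ← Complex.exp_add, Complex.re_ofReal_mul, ← add_mul, ← Complex.ofReal_add,
    Complex.exp_ofReal_mul_I_re]
  congr 2

lemma mass_near_multiples {P : Finset ℕ} {w x : ℕ → ℝ} {Y C h₀ ε t θ : ℝ}
    (H : SpreadOut P w x Y C h₀) (hY : 1 ≤ Y) (hC : 0 ≤ C) (hε : 0 < ε) (hε1 : ε ≤ 1)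
    (hh : h₀ ≤ 2 * ε) (ht : 0 < t) (ht1 : t ≤ 1) :
    ∑ p ∈ P with |t * x p - θ - 2 * π * ⌊(t * x p - θ) / (2 * π) + 1 / 2⌋| ≤ ε * min 1 (t * Y),
      w p ≤ 12 * C * √ε := by
  set m := min 1 (t * Y) with hm
  set M := max 1 (t * Y) with hM
  have hp := pi_gt_three
  have hY0 : 0 < Y := by linarith
  have hm0 : 0 < m := lt_min one_pos (by positivity)
  have hMm : m * M = t * Y := by rw [hm, hM, min_mul_max, one_mul]
  have hMY : M ≤ Y := max_le hY (by nlinarith)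
  have hM1 : 1 ≤ M := le_max_left _ _
  set h := 2 * ε * m / t with hhdef
  have hmt : t ≤ m := le_min ht1 (by nlinarith)
  have hh2 : 2 * ε ≤ h := by
    rw [hhdef, le_div_iff₀ ht]; nlinarith
  have hh0 : 0 < h := by positivity
  set g : ℕ → ℤ := fun p => ⌊(t * x p - θ) / (2 * π) + 1 / 2⌋ with hg
  set a : ℤ := ⌊(t * Y - θ) / (2 * π) + 1 / 2⌋ with ha
  set b : ℤ := ⌊(t * (2 * Y) - θ) / (2 * π) + 1 / 2⌋ with hb
  have hmaps : ∀ p ∈ P.filter (fun p => |t * x p - θ - 2 * π * (g p : ℤ)| ≤ ε * m),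
      g p ∈ Finset.Icc a b := by
    intro p hp'
    have hpP := (Finset.mem_filter.1 hp').1
    rw [Finset.mem_Icc]
    constructor
    · apply Int.floor_le_floor
      have := H.ge p hpP
      gcongr
    · apply Int.floor_le_floor
      have := H.le p hpP
      gcongr
  rw [← Finset.sum_fiberwise_of_maps_to hmaps]
  have hfib : ∀ n ∈ Finset.Icc a b,
      ∑ p ∈ (P.filter (fun p => |t * x p - θ - 2 * π * (g p : ℤ)| ≤ ε * m)) with g p = n, w p ≤
        C * (√h + h) / Y := by
    intro n _
    refine le_trans ?_ (H.mass ((θ + 2 * π * n - ε * m) / t) h (hh.trans hh2))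
    apply Finset.sum_le_sum_of_subset_of_nonneg
    · intro p hp'
      simp only [Finset.mem_filter] at hp' ⊢
      obtain ⟨⟨hpP, hab⟩, hn⟩ := hp'
      rw [hn, abs_le] at hab
      refine ⟨hpP, ?_, ?_⟩
      · rw [div_le_iff₀ ht]; linarith
      · rw [hhdef, ← add_div, le_div_iff₀ ht]; linarith
    · intro p hp' _
      exact H.nonneg p (Finset.mem_filter.1 hp').1
  refine (Finset.sum_le_card_nsmul _ _ _ hfib).trans ?_
  rw [nsmul_eq_mul]
  have hab : a ≤ b := by
    apply Int.floor_le_floor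
    gcongr
    linarith
  have hcard : ((Finset.Icc a b).card : ℝ) ≤ 3 * M := by
    rw [Int.card_Icc]
    have h1 : (((b + 1 - a).toNat : ℤ) : ℝ) = b + 1 - a := by
      rw [Int.toNat_of_nonneg (by omega)]; push_cast; ring
    have h2 : (b : ℝ) ≤ (t * (2 * Y) - θ) / (2 * π) + 1 / 2 := Int.floor_le _
    have h3 : (t * Y - θ) / (2 * π) + 1 / 2 < a + 1 := Int.lt_floor_add_one _
    have h4 : (t * (2 * Y) - θ) / (2 * π) - (t * Y - θ) / (2 * π) = t * Y / (2 * π) := by ring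
    have h5 : t * Y / (2 * π) ≤ M := by
      rw [div_le_iff₀ (by positivity)]
      have : t * Y ≤ M := le_max_right _ _
      nlinarith
    have h6 : (((b + 1 - a).toNat : ℤ) : ℝ) = ((b + 1 - a).toNat : ℝ) := by norm_cast
    linarith
  have k1 : M * h = 2 * ε * Y := by
    rw [hhdef]; field_simp; linear_combination hMm
  have k2 : M * √h ≤ √(2 * ε) * Y := by
    have e1 : M * √h = √(M ^ 2 * h) := by rw [sqrt_mul (by positivity), sqrt_sq (by linarith)]
    have e2 : √(2 * ε) * Y = √(2 * ε * Y ^ 2) := by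
      rw [sqrt_mul (by positivity) (Y ^ 2), sqrt_sq hY0.le]
    rw [e1, e2]
    apply sqrt_le_sqrt
    have : M ^ 2 * h = M * (2 * ε * Y) := by rw [← k1]; ring
    rw [this]
    nlinarith [mul_le_mul_of_nonneg_right hMY (by positivity : 0 ≤ 2 * ε * Y)]
  have k3 : √(2 * ε) ≤ 2 * √ε := by
    rw [sqrt_mul (by norm_num)]
    have : √2 ≤ 2 := by rw [sqrt_le_left (by norm_num)]; norm_num
    gcongr
  have k4 : ε ≤ √ε := by
    apply le_sqrt_of_sq_le; nlinarith
  calc _ ≤ 3 * M * (C * (√h + h) / Y) := by gcongr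
    _ = 3 * C * ((M * √h + M * h) / Y) := by ring
    _ ≤ 3 * C * ((√(2 * ε) * Y + 2 * ε * Y) / Y) := by rw [k1]; gcongr
    _ = 3 * C * (√(2 * ε) + 2 * ε) := by field_simp
    _ ≤ 3 * C * (2 * √ε + 2 * √ε) := by gcongr
    _ = _ := by ring

lemma norm_expSum_le {P : Finset ℕ} {w x : ℕ → ℝ} {Y C h₀ ε t : ℝ}
    (H : SpreadOut P w x Y C h₀) (hY : 1 ≤ Y) (hC : 0 ≤ C) (hε : 0 < ε) (hε1 : ε ≤ 1)
    (hh : h₀ ≤ 2 * ε) (hW : 24 * C * √ε ≤ ∑ p ∈ P, w p) (ht : 0 < t) (ht1 : t ≤ 1) :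
    ‖expSum P w x t‖ ≤ (∑ p ∈ P, w p) * (1 - ε ^ 2 / π ^ 2 * min 1 (t * Y) ^ 2) := by
  obtain ⟨θ, hθ⟩ := norm_expSum_eq P w x t
  have hbad := mass_near_multiples (θ := θ) H hY hC hε hε1 hh ht ht1
  set m := min 1 (t * Y) with hm
  have hm0 : 0 < m := lt_min one_pos (by nlinarith)
  set d : ℕ → ℝ := fun p => t * x p - θ - 2 * π * ⌊(t * x p - θ) / (2 * π) + 1 / 2⌋ with hd
  have hp := pi_pos
  have hdpi : ∀ p, |d p| ≤ π := by
    intro p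
    have h1 := Int.floor_le ((t * x p - θ) / (2 * π) + 1 / 2)
    have h2 := Int.lt_floor_add_one ((t * x p - θ) / (2 * π) + 1 / 2)
    have e : t * x p - θ = 2 * π * ((t * x p - θ) / (2 * π)) := by field_simp
    rw [abs_le, hd]
    dsimp only
    constructor <;> nlinarith
  have hcos : ∀ p, cos (t * x p - θ) = cos (d p) := by
    intro p
    have : d p = t * x p - θ - ⌊(t * x p - θ) / (2 * π) + 1 / 2⌋ * (2 * π) := by
      simp only [hd]; ring
    rw [this, cos_sub_int_mul_two_pi]
  rw [hθ]
  have hsplit := Finset.sum_filter_add_sum_filter_not P (fun p => |d p| ≤ ε * m) w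
  have key : ∀ p ∈ P, w p * cos (t * x p - θ) ≤
      w p - 2 / π ^ 2 * (ε * m) ^ 2 * (if ¬ |d p| ≤ ε * m then w p else 0) := by
    intro p hpP
    have hw := H.nonneg p hpP
    rw [hcos]
    split_ifs with h
    · have := cos_le_one (d p)
      nlinarith
    · have h1 := cos_le_one_sub_mul_cos_sq (hdpi p)
      have h2 : (ε * m) ^ 2 ≤ d p ^ 2 := by
        rw [← sq_abs (d p)]
        have : 0 ≤ ε * m := by positivity
        push Not at h
        gcongr
      have h3 : 2 / π ^ 2 * (ε * m) ^ 2 ≤ 2 / π ^ 2 * d p ^ 2 := by gcongr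
      nlinarith
  refine (Finset.sum_le_sum key).trans ?_
  rw [Finset.sum_sub_distrib, ← Finset.mul_sum, ← Finset.sum_filter]
  have hgood : (∑ p ∈ P, w p) / 2 ≤ ∑ p ∈ P with ¬ |d p| ≤ ε * m, w p := by linarith
  have h0 : 0 ≤ 2 / π ^ 2 * (ε * m) ^ 2 := by positivity
  have := mul_le_mul_of_nonneg_left hgood h0
  calc _ ≤ ∑ p ∈ P, w p - 2 / π ^ 2 * (ε * m) ^ 2 * ((∑ p ∈ P, w p) / 2) := by linarith
    _ = _ := by ring

lemma norm_expSum_sq (P : Finset ℕ) (w x : ℕ → ℝ) (t : ℝ) :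
    ‖expSum P w x t‖ ^ 2 = ∑ p ∈ P, ∑ q ∈ P, w p * w q * cos (t * (x p - x q)) := by
  have h : ((‖expSum P w x t‖ ^ 2 : ℝ) : ℂ) =
      expSum P w x t * (starRingEnd ℂ) (expSum P w x t) := by
    rw [Complex.mul_conj, Complex.normSq_eq_norm_sq]
  have h2 : ‖expSum P w x t‖ ^ 2 =
      (expSum P w x t * (starRingEnd ℂ) (expSum P w x t)).re := by rw [← h, Complex.ofReal_re]
  rw [h2, expSum, map_sum, Finset.sum_mul_sum, Complex.re_sum]
  refine Finset.sum_congr rfl fun p _ => ?_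
  rw [Complex.re_sum]
  refine Finset.sum_congr rfl fun q _ => ?_
  have : (starRingEnd ℂ) ((w q : ℂ) * Complex.exp ((t * x q : ℝ) * Complex.I)) =
      (w q : ℂ) * Complex.exp ((-(t * x q) : ℝ) * Complex.I) := by
    rw [map_mul, Complex.conj_ofReal, ← Complex.exp_conj, map_mul, Complex.conj_ofReal,
      Complex.conj_I]
    simp
  rw [this, mul_mul_mul_comm, ← Complex.exp_add, ← add_mul, ← Complex.ofReal_add,
    ← Complex.ofReal_mul, Complex.re_ofReal_mul, Complex.exp_ofReal_mul_I_re]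
  congr 2
  ring

lemma integral_two_sub_mul_cos_le (x : ℝ) :
    ∫ t in (0 : ℝ)..2, (2 - t) * cos (t * x) ≤ 4 / (1 + x ^ 2) := by
  have hx1 : ∫ t in (0 : ℝ)..2, (2 - t) * cos (t * x) ≤ 2 := by
    have h : ∫ t in (0 : ℝ)..2, (2 - t) * cos (t * x) ≤ ∫ t in (0 : ℝ)..2, (2 - t) := by
      apply intervalIntegral.integral_mono_on (by norm_num)
      · apply Continuous.intervalIntegrable; fun_prop
      · apply Continuous.intervalIntegrable; fun_prop
      · intro t ht
        have := cos_le_one (t * x)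
        nlinarith [ht.2]
    have h2 : ∫ t in (0 : ℝ)..2, (2 - t) = 2 := by
      rw [intervalIntegral.integral_sub (by simp) (by simp)]
      simp
      norm_num
    linarith
  rw [le_div_iff₀ (by positivity)]
  rcases eq_or_ne x 0 with rfl | hx
  · linarith
  have hx2 : (∫ t in (0 : ℝ)..2, (2 - t) * cos (t * x)) * x ^ 2 ≤ 2 := by
    have hd : ∀ t ∈ Set.uIcc (0 : ℝ) 2, HasDerivAt (fun t => (2 - t) * sin (t * x) / x
        - cos (t * x) / x ^ 2) ((2 - t) * cos (t * x)) t := by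
      intro t _
      have e1 : HasDerivAt (fun t : ℝ => t * x) x t := by simpa using (hasDerivAt_id t).mul_const x
      have e4 : HasDerivAt (fun t : ℝ => 2 - t) (-1) t := by
        simpa using (hasDerivAt_id t).const_sub 2
      refine (((e4.mul e1.sin).div_const x).sub (e1.cos.div_const (x ^ 2))).congr_deriv ?_
      field_simp
      ring
    rw [intervalIntegral.integral_eq_sub_of_hasDerivAt hd
      (Continuous.intervalIntegrable (by fun_prop) _ _)]
    have := neg_one_le_cos (2 * x)
    simp
    field_simp
    linarith
  linarith

lemma exists_sum_inv_one_add_sq_le :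
    ∃ B : ℝ, 0 < B ∧ ∀ s : Finset ℤ, ∑ n ∈ s, 1 / (1 + (n : ℝ) ^ 2) ≤ B := by
  have hs : Summable fun n : ℤ => 1 / (1 + (n : ℝ) ^ 2) := by
    refine Summable.of_nonneg_of_le (fun n => by positivity) (fun n => ?_)
      ((Real.summable_one_div_int_pow (p := 2)).2 (by norm_num) |>.add
        (summable_of_hasFiniteSupport (f := fun n : ℤ => if n = 0 then (1 : ℝ) else 0) ?_))
    · rcases eq_or_ne n 0 with rfl | h
      · simp
      · have : (0 : ℝ) < (n : ℝ) ^ 2 := by positivity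
        simp only [h, if_false, add_zero]
        gcongr
        linarith
    · refine (Set.finite_singleton (0 : ℤ)).subset ?_
      intro n hn
      by_contra h
      simp at h
      simp [h] at hn
  refine ⟨∑' n : ℤ, 1 / (1 + (n : ℝ) ^ 2) + 1, by positivity, fun s => ?_⟩
  linarith [hs.sum_le_tsum s fun n _ => by positivity]

lemma one_div_one_add_sq_le_floor (x : ℝ) :
    1 / (1 + x ^ 2) ≤ 3 * (1 / (1 + (⌊x⌋ : ℝ) ^ 2)) := by
  rw [mul_one_div, div_le_div_iff₀ (by positivity) (by positivity)]
  have h1 := Int.floor_le x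
  have h2 := Int.lt_floor_add_one x
  have : |(⌊x⌋ : ℝ)| ≤ |x| + 1 := by
    rw [abs_le]
    constructor <;> cases abs_cases x <;> linarith
  have h3 : (⌊x⌋ : ℝ) ^ 2 ≤ (|x| + 1) ^ 2 := by
    rw [← sq_abs]; gcongr
  nlinarith [sq_nonneg (|x| - 1), sq_abs x]

lemma exists_integral_norm_expSum_sq_le :
    ∃ B : ℝ, 0 < B ∧ ∀ (P : Finset ℕ) (w x : ℕ → ℝ) (Y C h₀ : ℝ), 0 < Y → 0 ≤ C → h₀ ≤ 1 →
      SpreadOut P w x Y C h₀ →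
      ∫ t in (0 : ℝ)..1, ‖expSum P w x t‖ ^ 2 ≤ B * C * (∑ p ∈ P, w p) / Y := by
  obtain ⟨B, hB, hsum⟩ := exists_sum_inv_one_add_sq_le
  refine ⟨24 * B, by positivity, fun P w x Y C h₀ hY hC hh H => ?_⟩
  have hE := continuous_expSum P w x
  have h1 : ∫ t in (0 : ℝ)..1, ‖expSum P w x t‖ ^ 2 ≤
      ∫ t in (0 : ℝ)..2, (2 - t) * ‖expSum P w x t‖ ^ 2 := by
    have ii : ∀ a b, IntervalIntegrable (fun t => (2 - t) * ‖expSum P w x t‖ ^ 2)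
        MeasureTheory.volume a b := by
      intro a b; apply Continuous.intervalIntegrable; fun_prop
    rw [← intervalIntegral.integral_add_adjacent_intervals (ii 0 1) (ii 1 2)]
    have h2 : ∫ t in (0 : ℝ)..1, ‖expSum P w x t‖ ^ 2 ≤
        ∫ t in (0 : ℝ)..1, (2 - t) * ‖expSum P w x t‖ ^ 2 := by
      apply intervalIntegral.integral_mono_on zero_le_one _ (ii _ _)
      · intro t ht
        have := sq_nonneg ‖expSum P w x t‖
        nlinarith [ht.2]
      · apply Continuous.intervalIntegrable; fun_prop
    have h3 : 0 ≤ ∫ t in (1 : ℝ)..2, (2 - t) * ‖expSum P w x t‖ ^ 2 := by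
      apply intervalIntegral.integral_nonneg (by norm_num)
      intro t ht
      have : 0 ≤ 2 - t := by linarith [ht.2]
      positivity
    linarith
  refine h1.trans ?_
  have h4 : ∫ t in (0 : ℝ)..2, (2 - t) * ‖expSum P w x t‖ ^ 2 =
      ∑ p ∈ P, ∑ q ∈ P, w p * w q * ∫ t in (0 : ℝ)..2, (2 - t) * cos (t * (x p - x q)) := by
    simp_rw [norm_expSum_sq, Finset.mul_sum, mul_left_comm (2 - _ : ℝ)]
    rw [intervalIntegral.integral_finsetSum]
    · refine Finset.sum_congr rfl fun p _ => ?_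
      rw [intervalIntegral.integral_finsetSum]
      · simp_rw [intervalIntegral.integral_const_mul]
      · intro q _
        apply Continuous.intervalIntegrable; fun_prop
    · intro q _
      apply Continuous.intervalIntegrable; fun_prop
  rw [h4]
  have h5 : ∀ p ∈ P, ∑ q ∈ P, w p * w q * ∫ t in (0 : ℝ)..2, (2 - t) * cos (t * (x p - x q)) ≤
      w p * (24 * B * C / Y) := by
    intro p hp
    simp_rw [mul_assoc]
    rw [← Finset.mul_sum]
    apply mul_le_mul_of_nonneg_left _ (H.nonneg p hp)
    set g : ℕ → ℤ := fun q => ⌊x q - x p⌋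
    have h6 : ∀ q ∈ P, w q * ∫ t in (0 : ℝ)..2, (2 - t) * cos (t * (x p - x q)) ≤
        12 * (w q * (1 / (1 + (g q : ℝ) ^ 2))) := by
      intro q hq
      have := H.nonneg q hq
      have e : x p - x q = -(x q - x p) := by ring
      have h7 : ∫ t in (0 : ℝ)..2, (2 - t) * cos (t * (x p - x q)) ≤
          12 * (1 / (1 + (g q : ℝ) ^ 2)) := by
        refine (integral_two_sub_mul_cos_le _).trans ?_
        rw [e, neg_sq]
        have := one_div_one_add_sq_le_floor (x q - x p)
        rw [← mul_one_div]
        linarith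
      nlinarith
    refine (Finset.sum_le_sum h6).trans ?_
    rw [← Finset.mul_sum, ← Finset.sum_fiberwise_of_maps_to
      (fun q hq => Finset.mem_image_of_mem g hq)]
    have h8 : ∀ n ∈ P.image g, ∑ q ∈ P with g q = n, w q * (1 / (1 + (g q : ℝ) ^ 2)) ≤
        2 * C / Y * (1 / (1 + (n : ℝ) ^ 2)) := by
      intro n _
      have : ∑ q ∈ P with g q = n, w q * (1 / (1 + (g q : ℝ) ^ 2)) =
          (∑ q ∈ P with g q = n, w q) * (1 / (1 + (n : ℝ) ^ 2)) := by
        rw [Finset.sum_mul]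
        refine Finset.sum_congr rfl fun q hq => ?_
        rw [(Finset.mem_filter.1 hq).2]
      rw [this]
      apply mul_le_mul_of_nonneg_right _ (by positivity)
      have hm := H.mass (x p + n) 1 hh
      rw [sqrt_one] at hm
      refine le_trans ?_ (hm.trans_eq (by ring))
      apply Finset.sum_le_sum_of_subset_of_nonneg
      · intro q hq
        simp only [Finset.mem_filter] at hq ⊢
        have h9 := Int.floor_eq_iff.1 hq.2
        exact ⟨hq.1, by linarith, by linarith⟩
      · intro q hq _
        exact H.nonneg q (Finset.mem_filter.1 hq).1
    refine (mul_le_mul_of_nonneg_left (Finset.sum_le_sum h8) (by norm_num)).trans ?_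
    rw [← Finset.mul_sum]
    have := mul_le_mul_of_nonneg_left (hsum (P.image g)) (by positivity : 0 ≤ 2 * C / Y)
    calc _ ≤ 12 * (2 * C / Y * B) := by linarith
      _ = _ := by ring
  refine (Finset.sum_le_sum h5).trans_eq ?_
  rw [← Finset.sum_mul]
  ring

lemma abs_smoothCount_le {P : Finset ℕ} {w : ℕ → ℝ} (x : ℕ → ℝ) (hw : ∀ p ∈ P, 0 ≤ w p) (k : ℕ)
    (τ : ℝ) : |smoothCount P w x k τ| ≤ 4 * (∑ p ∈ P, w p) ^ k := by
  rw [Finset.sum_pow', Finset.mul_sum, smoothCount]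
  refine (Finset.abs_sum_le_sum_abs _ _).trans (Finset.sum_le_sum fun q hq => ?_)
  have h0 : 0 ≤ ∏ i, w (q i) :=
    Finset.prod_nonneg fun i _ => hw _ (Fintype.mem_piFinset.1 hq i)
  rw [abs_mul, abs_of_nonneg h0, mul_comm]
  exact mul_le_mul_of_nonneg_right (abs_selbergKernel_le _) h0

lemma exists_near_max_smoothCount {P : Finset ℕ} {w x : ℕ → ℝ} {Y : ℝ} {k : ℕ}
    (hw : ∀ p ∈ P, 0 ≤ w p) (hge : ∀ p ∈ P, Y ≤ x p) (hle : ∀ p ∈ P, x p ≤ 2 * Y)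
    (hW : 0 < ∑ p ∈ P, w p) (hkY : 4 * π ≤ k * Y) :
    ∃ τ, k * Y - 2 * π ≤ τ ∧ τ ≤ 2 * (k * Y) + 2 * π ∧
      4 / 25 * (∑ p ∈ P, w p) ^ k / (k * Y) ≤ smoothCount P w x k τ ∧
      ∀ σ, smoothCount P w x k σ ≤ 5 / 4 * smoothCount P w x k τ := by
  set W := ∑ p ∈ P, w p with hWdef
  have hp := pi_pos
  have hcont : Continuous (smoothCount P w x k) := by
    have := continuous_selbergKernel
    unfold smoothCount
    fun_prop
  have hkY0 : 0 < k * Y := by linarith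
  have hint : 2 / 5 * W ^ k ≤ ∫ τ in (k * Y - 2 * π)..(2 * (k * Y) + 2 * π),
      smoothCount P w x k τ := by
    simp_rw [smoothCount]
    rw [intervalIntegral.integral_finsetSum]
    · rw [hWdef, Finset.sum_pow', Finset.mul_sum]
      refine Finset.sum_le_sum fun q hq => ?_
      have hq' := Fintype.mem_piFinset.1 hq
      have h0 : 0 ≤ ∏ i, w (q i) := Finset.prod_nonneg fun i _ => hw _ (hq' i)
      rw [intervalIntegral.integral_const_mul, mul_comm]
      refine mul_le_mul_of_nonneg_left ?_ h0
      rw [intervalIntegral.integral_comp_sub_left]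
      have h1 : k * Y ≤ ∑ i, x (q i) := by
        simpa using Finset.card_nsmul_le_sum Finset.univ (fun i => x (q i)) Y
          fun i _ => hge _ (hq' i)
      have h2 : ∑ i, x (q i) ≤ k * (2 * Y) := by
        simpa using Finset.sum_le_card_nsmul Finset.univ (fun i => x (q i)) (2 * Y)
          fun i _ => hle _ (hq' i)
      apply integral_selbergKernel_ge <;> linarith
    · intro q _
      have := continuous_selbergKernel
      apply Continuous.intervalIntegrable
      fun_prop
  have hexists : ∃ τ, W ^ k / (5 * (k * Y)) ≤ smoothCount P w x k τ := by
    by_contra! hcon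
    have h1 : ∫ τ in (k * Y - 2 * π)..(2 * (k * Y) + 2 * π), smoothCount P w x k τ <
        ∫ τ in (k * Y - 2 * π)..(2 * (k * Y) + 2 * π), W ^ k / (5 * (k * Y)) := by
      apply intervalIntegral.integral_lt_integral_of_continuousOn_of_le_of_exists_lt
        (by linarith) hcont.continuousOn continuousOn_const (fun τ _ => (hcon τ).le)
      exact ⟨k * Y - 2 * π, ⟨le_rfl, by linarith⟩, hcon _⟩
    rw [intervalIntegral.integral_const, smul_eq_mul] at h1
    have h2 : (2 * (k * Y) + 2 * π - (k * Y - 2 * π)) * (W ^ k / (5 * (k * Y))) ≤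
        (2 * (k * Y)) * (W ^ k / (5 * (k * Y))) := by
      apply mul_le_mul_of_nonneg_right (by linarith) (by positivity)
    have h3 : (2 * (k * Y)) * (W ^ k / (5 * (k * Y))) = 2 / 5 * W ^ k := by
      field_simp; exact div_self hkY0.ne'
    linarith
  obtain ⟨τ₀, hτ₀⟩ := hexists
  have hbdd : BddAbove (Set.range (smoothCount P w x k)) :=
    ⟨4 * W ^ k, by rintro _ ⟨τ, rfl⟩; exact (abs_le.1 (abs_smoothCount_le x hw k τ)).2⟩
  have hM : smoothCount P w x k τ₀ ≤ ⨆ τ, smoothCount P w x k τ := le_ciSup hbdd τ₀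
  have hpos : 0 < W ^ k / (5 * (k * Y)) := by positivity
  obtain ⟨τ, hτ⟩ := exists_lt_of_lt_ciSup
    (show 4 / 5 * (⨆ τ, smoothCount P w x k τ) < ⨆ τ, smoothCount P w x k τ by linarith)
  have h4 : 4 / 5 * (W ^ k / (5 * (k * Y))) = 4 / 25 * W ^ k / (k * Y) := by field_simp; norm_num
  have hτpos : 0 < smoothCount P w x k τ := by linarith
  obtain ⟨q, hq, hqpos⟩ := Finset.exists_lt_of_sum_lt
    (s := Fintype.piFinset (fun _ : Fin k => P)) (f := fun _ => (0 : ℝ))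
    (by simpa [smoothCount] using hτpos)
  have hq' := Fintype.mem_piFinset.1 hq
  have h0 : 0 ≤ ∏ i, w (q i) := Finset.prod_nonneg fun i _ => hw _ (hq' i)
  have hnear : |∑ i, x (q i) - τ| ≤ 2 * π := by
    by_contra! hcon
    have := mul_nonpos_of_nonneg_of_nonpos h0 (selbergKernel_nonpos hcon)
    linarith
  have h1 : k * Y ≤ ∑ i, x (q i) := by
    simpa using Finset.card_nsmul_le_sum Finset.univ (fun i => x (q i)) Y
      fun i _ => hge _ (hq' i)
  have h2 : ∑ i, x (q i) ≤ k * (2 * Y) := by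
    simpa using Finset.sum_le_card_nsmul Finset.univ (fun i => x (q i)) (2 * Y)
      fun i _ => hle _ (hq' i)
  obtain ⟨h5, h6⟩ := abs_le.1 hnear
  refine ⟨τ, by linarith, by linarith, by linarith, fun σ => ?_⟩
  have := le_ciSup hbdd σ
  linarith

lemma exp_sq_le_eight : exp 2 ≤ 8 := by
  have := exp_one_lt_d9
  have e : exp 2 = exp 1 ^ 2 := by rw [← exp_nat_mul]; norm_num
  rw [e]; nlinarith [exp_pos 1]

lemma integral_exp_neg_mul_sq_le {b : ℝ} (hb : 0 < b) :
    ∫ t in (0 : ℝ)..1, exp (-b * t ^ 2) ≤ √(π / b) := by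
  rw [← integral_gaussian b, intervalIntegral.integral_of_le zero_le_one]
  exact MeasureTheory.setIntegral_le_integral (integrable_exp_neg_mul_sq hb)
    (Filter.Eventually.of_forall fun t => (exp_pos _).le)

lemma integral_norm_expSum_pow_mul_le {P : Finset ℕ} {w x : ℕ → ℝ} {Y W c D : ℝ} {k : ℕ}
    (hY : 0 < Y) (hW : 0 < W) (hc : 0 < c) (hc1 : c ≤ 1) (hk : 2 ≤ k)
    (hψ : ∀ t, 0 < t → t ≤ 1 → ‖expSum P w x t‖ ≤ W * (1 - c * min 1 (t * Y) ^ 2))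
    (hL2 : ∫ t in (0 : ℝ)..1, ‖expSum P w x t‖ ^ 2 ≤ D * W / Y)
    (h1 : 2 * π * 1600 ^ 2 ≤ c ^ 3 * k) (h2 : 48 * 1600 * D ≤ W * c ^ 3 * k ^ 2) :
    ∫ t in (0 : ℝ)..1, ‖expSum P w x t‖ ^ k * min 1 (t * Y) ^ 2 ≤ W ^ k / (800 * (k * Y)) := by
  have hE := continuous_expSum P w x
  have hp := pi_pos
  have hk0 : (0 : ℝ) < k := by positivity
  set a := c * k with ha
  have ha0 : 0 < a := by positivity
  have hpt : ∀ t ∈ Set.Ioc (0 : ℝ) 1, ‖expSum P w x t‖ ^ k * min 1 (t * Y) ^ 2 ≤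
      W ^ k / a * exp (-(a * Y ^ 2 / 2) * t ^ 2) +
        (W * exp (-c)) ^ (k - 2) * ‖expSum P w x t‖ ^ 2 := by
    rintro t ⟨ht0, ht1⟩
    have hb := hψ t ht0 ht1
    rcases le_total (t * Y) 1 with h | h
    · rw [min_eq_right h] at hb ⊢
      have hb2 : ‖expSum P w x t‖ ≤ W * exp (-(c * (t * Y) ^ 2)) :=
        hb.trans (mul_le_mul_of_nonneg_left (by
          have := add_one_le_exp (-(c * (t * Y) ^ 2)); linarith) hW.le)
      have hb3 : ‖expSum P w x t‖ ^ k ≤ W ^ k * exp (-(a * (t * Y) ^ 2)) := by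
        refine (pow_le_pow_left₀ (norm_nonneg _) hb2 k).trans (le_of_eq ?_)
        rw [mul_pow, ← exp_nat_mul]
        congr 2; rw [ha]; ring
      have hb4 : exp (-(a * (t * Y) ^ 2)) * (t * Y) ^ 2 ≤
          1 / a * exp (-(a * Y ^ 2 / 2) * t ^ 2) := by
        set u := a * (t * Y) ^ 2 with hu
        have e1 : -(a * Y ^ 2 / 2) * t ^ 2 = -(u / 2) := by rw [hu]; ring
        have e2 : exp (-u) = exp (-(u / 2)) * exp (-(u / 2)) := by rw [← exp_add]; congr 1; ring
        have e3 : exp (-(u / 2)) * u ≤ 1 := by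
          rw [exp_neg, inv_mul_le_iff₀ (exp_pos _)]
          have := quadratic_le_exp_of_nonneg (show 0 ≤ u / 2 by positivity)
          nlinarith [sq_nonneg (u / 2 - 1)]
        have e4 : (t * Y) ^ 2 = u / a := by rw [hu]; field_simp
        rw [e1, e2, e4, mul_assoc, mul_comm]
        refine mul_le_mul_of_nonneg_right ?_ (exp_pos _).le
        rw [← mul_div_assoc]
        gcongr
      have : 0 ≤ (W * exp (-c)) ^ (k - 2) * ‖expSum P w x t‖ ^ 2 := by positivity
      calc _ ≤ W ^ k * exp (-(a * (t * Y) ^ 2)) * (t * Y) ^ 2 := by gcongr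
        _ = W ^ k * (exp (-(a * (t * Y) ^ 2)) * (t * Y) ^ 2) := by ring
        _ ≤ W ^ k * (1 / a * exp (-(a * Y ^ 2 / 2) * t ^ 2)) := by gcongr
        _ = W ^ k / a * exp (-(a * Y ^ 2 / 2) * t ^ 2) := by ring
        _ ≤ _ := by linarith
    · rw [min_eq_left h] at hb ⊢
      have hb2 : ‖expSum P w x t‖ ≤ W * exp (-c) :=
        hb.trans (mul_le_mul_of_nonneg_left (by
          have := add_one_le_exp (-c); linarith) hW.le)
      have e : ‖expSum P w x t‖ ^ k = ‖expSum P w x t‖ ^ (k - 2) * ‖expSum P w x t‖ ^ 2 := by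
        rw [← pow_add]; congr 1; omega
      have h3 : ‖expSum P w x t‖ ^ k * 1 ^ 2 ≤
          (W * exp (-c)) ^ (k - 2) * ‖expSum P w x t‖ ^ 2 := by
        rw [e, one_pow, mul_one]; gcongr
      have : 0 ≤ W ^ k / a * exp (-(a * Y ^ 2 / 2) * t ^ 2) := by positivity
      linarith
  have hint : ∫ t in (0 : ℝ)..1, ‖expSum P w x t‖ ^ k * min 1 (t * Y) ^ 2 ≤
      W ^ k / a * √(π / (a * Y ^ 2 / 2)) + (W * exp (-c)) ^ (k - 2) * (D * W / Y) := by
    have i1 : IntervalIntegrable (fun t => W ^ k / a * exp (-(a * Y ^ 2 / 2) * t ^ 2))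
        MeasureTheory.volume 0 1 := by apply Continuous.intervalIntegrable; fun_prop
    have i2 : IntervalIntegrable (fun t => (W * exp (-c)) ^ (k - 2) * ‖expSum P w x t‖ ^ 2)
        MeasureTheory.volume 0 1 := by apply Continuous.intervalIntegrable; fun_prop
    refine (intervalIntegral.integral_mono_on_of_le_Ioo zero_le_one ?_ (i1.add i2)
      fun t ht => hpt t ⟨ht.1, ht.2.le⟩).trans ?_
    · apply Continuous.intervalIntegrable; fun_prop
    rw [intervalIntegral.integral_add i1 i2, intervalIntegral.integral_const_mul,
      intervalIntegral.integral_const_mul]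
    gcongr
    exact integral_exp_neg_mul_sq_le (by positivity)
  refine hint.trans ?_
  have t1 : W ^ k / a * √(π / (a * Y ^ 2 / 2)) ≤ W ^ k / (1600 * (k * Y)) := by
    have : √(π / (a * Y ^ 2 / 2)) ≤ a / (1600 * (k * Y)) := by
      rw [sqrt_le_left (by positivity), div_pow, div_le_div_iff₀ (by positivity) (by positivity)]
      have : a ^ 3 = c ^ 3 * k * k ^ 2 := by rw [ha]; ring
      have e : a ^ 2 * (a * Y ^ 2 / 2) = a ^ 3 * Y ^ 2 / 2 := by ring
      rw [e, this]
      have := mul_le_mul_of_nonneg_right h1 (show 0 ≤ (k : ℝ) ^ 2 * Y ^ 2 / 2 by positivity)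
      linarith
    calc _ ≤ W ^ k / a * (a / (1600 * (k * Y))) := by gcongr
      _ = _ := by field_simp
  have t2 : (W * exp (-c)) ^ (k - 2) * (D * W / Y) ≤ W ^ k / (1600 * (k * Y)) := by
    have e1 : (W * exp (-c)) ^ (k - 2) ≤ W ^ (k - 2) * (48 / a ^ 3) := by
      rw [mul_pow, ← exp_nat_mul]
      gcongr
      rw [Nat.cast_sub hk]
      have e : ((k : ℝ) - (2 : ℕ)) * -c = 2 * c + -a := by rw [ha]; push_cast; ring
      rw [e, exp_add, exp_neg, ← div_eq_mul_inv, div_le_div_iff₀ (exp_pos _) (by positivity)]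
      have h6 : exp (2 * c) ≤ 8 := (exp_le_exp.2 (by linarith)).trans exp_sq_le_eight
      have h7 : a ^ 3 / 6 ≤ exp a := by
        have := pow_div_factorial_le_exp a ha0.le 3
        simpa [Nat.factorial] using this
      have : exp (2 * c) * a ^ 3 ≤ 8 * a ^ 3 := by gcongr
      linarith
    by_cases hD : D ≤ 0
    · have : D * W / Y ≤ 0 := by
        apply div_nonpos_of_nonpos_of_nonneg (mul_nonpos_of_nonpos_of_nonneg hD hW.le) hY.le
      have h8 : (W * exp (-c)) ^ (k - 2) * (D * W / Y) ≤ 0 :=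
        mul_nonpos_of_nonneg_of_nonpos (by positivity) this
      exact h8.trans (by positivity)
    push Not at hD
    have e2 : W ^ k = W ^ (k - 2) * W ^ 2 := by rw [← pow_add]; congr 1; omega
    calc _ ≤ W ^ (k - 2) * (48 / a ^ 3) * (D * W / Y) := by gcongr
      _ ≤ _ := by
        rw [e2, ha, ← sub_nonneg]
        have : W ^ (k - 2) * W ^ 2 / (1600 * (k * Y)) -
            W ^ (k - 2) * (48 / (c * k) ^ 3) * (D * W / Y) =
            W ^ (k - 2) * W / (1600 * c ^ 3 * k ^ 3 * Y) *
              (W * c ^ 3 * k ^ 2 - 48 * 1600 * D) := by field_simp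
        rw [this]
        exact mul_nonneg (by positivity) (by linarith)
  have : W ^ k / (800 * (k * Y)) = W ^ k / (1600 * (k * Y)) + W ^ k / (1600 * (k * Y)) := by
    field_simp; norm_num
  linarith

/-- Local lower bound for the number of `k`-tuples in a whole window around some `τ`. -/
lemma exists_window (C : ℝ) (hC : 1 ≤ C) :
    ∃ C₁ : ℝ, 0 < C₁ ∧ ∀ (W₀ : ℝ) (k : ℕ), 0 < W₀ → C₁ ≤ k * W₀ ^ 12 → ∃ h₀ : ℝ, 0 < h₀ ∧ h₀ ≤ 1 ∧
      ∀ (P : Finset ℕ) (w x : ℕ → ℝ) (Y : ℝ), 4 * π ≤ Y → SpreadOut P w x Y C h₀ →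
        W₀ ≤ ∑ p ∈ P, w p →
        ∃ τ, k * Y - 2 * π ≤ τ ∧ τ ≤ 2 * (k * Y) + 2 * π ∧
          ∀ σ, |σ - τ| ≤ 2 * Y →
            (∑ p ∈ P, w p) ^ k / (10 * (k * Y)) ≤ smoothCount P w x k σ := by
  obtain ⟨B, hB, hL2⟩ := exists_integral_norm_expSum_sq_le
  have hp := pi_pos
  set A := (24 * C) ^ 12 * π ^ 6 with hA
  have hA1 : 0 < A := by positivity
  refine ⟨max (2 * π * 1600 ^ 2 * A) (48 * 1600 * (B * C) * A * (2 * C) ^ 11), by positivity,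
    fun W₀ k hW₀ hk => ?_⟩
  set ε := (W₀ / (24 * C)) ^ 2 with hε
  have hε0 : 0 < ε := by positivity
  refine ⟨min 1 (2 * ε), by positivity, min_le_left _ _, fun P w x Y hY H hW => ?_⟩
  set W := ∑ p ∈ P, w p with hWdef
  have hpi := pi_gt_three
  have hY1 : 1 ≤ Y := by linarith
  have hWC : W ≤ 2 * C := by
    have h1 := H.mass Y Y ((min_le_left _ _).trans hY1)
    rw [Finset.filter_true_of_mem fun p hp => ⟨H.ge p hp, by linarith [H.le p hp]⟩] at h1
    refine h1.trans ?_
    rw [div_le_iff₀ (by linarith)]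
    have : √Y ≤ Y := sqrt_le_iff.2 ⟨by linarith, by nlinarith⟩
    nlinarith
  have hW0C : W₀ ≤ 2 * C := hW.trans hWC
  have hWpos : 0 < W := by linarith
  have hε1 : ε ≤ 1 := by
    rw [hε]; apply pow_le_one₀ (by positivity)
    rw [div_le_one (by positivity)]; linarith
  have hsε : 24 * C * √ε = W₀ := by
    rw [hε, sqrt_sq (by positivity)]; field_simp
  set c := ε ^ 2 / π ^ 2 with hc
  have hc0 : 0 < c := by positivity
  have hc1 : c ≤ 1 := by
    rw [hc, div_le_one (by positivity)]
    exact pow_le_pow_left₀ hε0.le (by linarith) 2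
  have hc3 : c ^ 3 = W₀ ^ 12 / A := by rw [hc, hε, hA]; field_simp
  have hk1 : 2 * π * 1600 ^ 2 ≤ c ^ 3 * k := by
    rw [hc3, div_mul_eq_mul_div, le_div_iff₀ hA1]
    linarith [(le_max_left _ _).trans hk]
  have hc31 : c ^ 3 ≤ 1 := pow_le_one₀ hc0.le hc1
  have hk2r : (2 : ℝ) ≤ k := by
    have : c ^ 3 * k ≤ 1 * k := by gcongr
    linarith
  have hk2 : 2 ≤ k := by exact_mod_cast hk2r
  have hk3 : 48 * 1600 * (B * C) ≤ W * c ^ 3 * k ^ 2 := by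
    have h1 := (le_max_right _ _).trans hk
    have h2 : 48 * 1600 * (B * C) * (2 * C) ^ 11 ≤ c ^ 3 * k := by
      rw [hc3, div_mul_eq_mul_div, le_div_iff₀ hA1]; linarith
    have h3 : 48 * 1600 * (B * C) * (2 * C) ^ 11 ≤ k * W₀ * (2 * C) ^ 11 := by
      have e : W₀ ^ 12 ≤ W₀ * (2 * C) ^ 11 := by
        have : W₀ ^ 11 ≤ (2 * C) ^ 11 := pow_le_pow_left₀ hW₀.le hW0C 11
        calc W₀ ^ 12 = W₀ * W₀ ^ 11 := by ring
          _ ≤ _ := by gcongr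
      have h4 : k * W₀ ^ 12 ≤ k * (W₀ * (2 * C) ^ 11) := by gcongr
      have h5 : 1 ≤ A := by
        rw [hA]
        exact one_le_mul_of_one_le_of_one_le (one_le_pow₀ (by linarith))
          (one_le_pow₀ (by linarith))
      have h6 : 48 * 1600 * (B * C) * (2 * C) ^ 11 * 1 ≤
          48 * 1600 * (B * C) * (2 * C) ^ 11 * A := by gcongr
      linarith
    have h4 : 48 * 1600 * (B * C) ≤ k * W₀ := le_of_mul_le_mul_right h3 (by positivity)
    have h5 : (1 : ℝ) ≤ c ^ 3 * k := by nlinarith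
    calc _ ≤ k * W₀ * 1 := by linarith
      _ ≤ k * W * (c ^ 3 * k) := by gcongr
      _ = _ := by ring
  have herr := integral_norm_expSum_pow_mul_le (P := P) (w := w) (x := x) (Y := Y) (W := W) (c := c)
    (D := B * C) (k := k) (by linarith) hWpos hc0 hc1 hk2
    (fun t h0 h1 => norm_expSum_le H hY1 (by linarith) hε0 hε1 (min_le_right _ _)
      (by rw [hsε]; exact hW) h0 h1)
    (hL2 P w x Y C _ (by linarith) (by linarith) (min_le_left _ _) H) hk1 hk3
  have hkY : 4 * π ≤ k * Y := by nlinarith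
  obtain ⟨τ, h1, h2, h3, h4⟩ := exists_near_max_smoothCount (k := k) H.nonneg H.ge H.le hWpos hkY
  refine ⟨τ, h1, h2, fun σ hσ => ?_⟩
  have h5 := two_mul_smoothCount_sub_le P w x k τ (σ - τ)
  rw [add_sub_cancel] at h5
  have hE := continuous_expSum P w x
  have h6 : ∫ t in (0 : ℝ)..1, ‖expSum P w x t‖ ^ k * (1 - cos (t * (σ - τ))) ≤
      2 * ∫ t in (0 : ℝ)..1, ‖expSum P w x t‖ ^ k * min 1 (t * Y) ^ 2 := by
    rw [← intervalIntegral.integral_const_mul]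
    refine intervalIntegral.integral_mono_on zero_le_one
      (by apply Continuous.intervalIntegrable; fun_prop)
      (by apply Continuous.intervalIntegrable; fun_prop) fun t ht => ?_
    rw [mul_left_comm]
    refine mul_le_mul_of_nonneg_left ?_ (by positivity)
    rcases le_total (t * Y) 1 with h | h
    · rw [min_eq_right h]
      have := one_sub_sq_div_two_le_cos (x := t * (σ - τ))
      have h7 : (t * (σ - τ)) ^ 2 ≤ (t * (2 * Y)) ^ 2 := by
        rw [mul_pow, mul_pow]
        exact mul_le_mul_of_nonneg_left (sq_le_sq' (by linarith [(abs_le.1 hσ).1])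
          (abs_le.1 hσ).2) (sq_nonneg _)
      nlinarith
    · rw [min_eq_left h]
      linarith [neg_one_le_cos (t * (σ - τ))]
  have h7 := h4 (τ - (σ - τ))
  have h8 : 4 / 25 * W ^ k / (k * Y) = 16 / 10 * (W ^ k / (10 * (k * Y))) := by field_simp; norm_num
  have h9 : W ^ k / (800 * (k * Y)) = 1 / 80 * (W ^ k / (10 * (k * Y))) := by field_simp; norm_num
  have h10 : 0 ≤ W ^ k / (10 * (k * Y)) := by positivity
  linarith

/-- A Brun–Titchmarsh-type bound for short intervals from the binomial coefficient. -/
lemma sum_log_prime_Ioc_le {n N : ℕ} (hn : 0 < n) (h1 : n ≤ N) (h2 : N ≤ 2 * n) :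
    ∑ p ∈ Finset.Ioc n N with p.Prime, log p ≤ 2 * √(((N : ℝ) - n) * N) := by
  obtain ⟨m, rfl⟩ := Nat.exists_eq_add_of_le h1
  rcases Nat.eq_zero_or_pos m with rfl | hm
  · simp
  have hdvd : ∏ p ∈ Finset.Ioc n (n + m) with p.Prime, p ∣ (n + m).choose m := by
    refine Finset.prod_primes_dvd _ (fun p hp => (Finset.mem_filter.1 hp).2.prime) fun p hp => ?_
    obtain ⟨hp1, hp2⟩ := Finset.mem_filter.1 hp
    rw [Finset.mem_Ioc] at hp1
    have h3 : p ∣ (n + m).choose m * m.factorial * n.factorial := by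
      have := Nat.choose_mul_factorial_mul_factorial (n := n + m) (k := m) (by omega)
      rw [Nat.add_sub_cancel] at this
      rw [this]
      exact (hp2.dvd_factorial).2 hp1.2
    rcases hp2.dvd_mul.1 h3 with h | h
    · rcases hp2.dvd_mul.1 h with h | h
      · exact h
      · have := (hp2.dvd_factorial).1 h; omega
    · have := (hp2.dvd_factorial).1 h; omega
  have hle := Nat.le_of_dvd (Nat.choose_pos (by omega)) hdvd
  have hm0 : (0 : ℝ) < m := by exact_mod_cast hm
  have hn0 : (0 : ℝ) < n := by exact_mod_cast hn
  have hlog : ∑ p ∈ Finset.Ioc n (n + m) with p.Prime, log p ≤ log ((n + m).choose m) := by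
    rw [← log_prod (fun p hp => by
      have := (Finset.mem_filter.1 hp).2.pos; positivity)]
    apply log_le_log
    · exact Finset.prod_pos fun p hp => by have := (Finset.mem_filter.1 hp).2.pos; positivity
    · rw [← Nat.cast_prod]; exact_mod_cast hle
  have hch : ((n + m).choose m : ℝ) ≤ ((n + m : ℝ) / m) ^ m * exp m := by
    have h3 := Nat.choose_le_pow_div (α := ℝ) m (n + m)
    have h4 := pow_div_factorial_le_exp (m : ℝ) hm0.le m
    calc ((n + m).choose m : ℝ) ≤ ((n + m : ℕ) : ℝ) ^ m / m.factorial := h3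
      _ = ((n + m : ℝ) / m) ^ m * ((m : ℝ) ^ m / m.factorial) := by
        push_cast; rw [div_pow]; field_simp
      _ ≤ _ := by gcongr
  set y := √((n + m : ℝ) / m) with hy
  have hy0 : 0 < y := by positivity
  have hy2 : (n + m : ℝ) / m = y ^ 2 := (sq_sqrt (by positivity)).symm
  have hfin : log ((n + m).choose m) ≤ m * (2 * y) := by
    refine (log_le_log (by exact_mod_cast Nat.choose_pos (by omega)) hch).trans ?_
    rw [log_mul (by positivity) (by positivity), log_exp, log_pow, hy2, log_pow]
    have := log_le_sub_one_of_pos hy0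
    push_cast
    nlinarith
  have e : √((((n + m : ℕ) : ℝ) - n) * ((n + m : ℕ) : ℝ)) = m * y := by
    rw [hy, sqrt_eq_iff_mul_self_eq (by push_cast; ring_nf; positivity) (by positivity)]
    have := hy2
    push_cast
    rw [← hy, show (m : ℝ) * y * (m * y) = m ^ 2 * y ^ 2 by ring, ← hy2]
    field_simp; ring
  rw [e]
  linarith

lemma sum_inv_prime_short {v η : ℝ} (hη : 0 < η) (hη1 : η ≤ 1 / 2) (hv : 3 ≤ v)
    (hvη : 1 / η ≤ exp v) (P : Finset ℕ) (hP : ∀ p ∈ P, p.Prime) :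
    ∑ p ∈ P with v ≤ log (p : ℕ) ∧ log p ≤ v + η, (1 : ℝ) / p ≤ 5 * √η / v := by
  set a := exp v with ha
  have ha0 : 0 < a := exp_pos v
  have ha20 : 20 ≤ a := by
    have h1 : exp 3 ≤ a := exp_le_exp.2 hv
    have h2 : exp 3 = exp 1 ^ 3 := by rw [← exp_nat_mul]; norm_num
    have h3 := exp_one_gt_d9
    have h4 : (2.718 : ℝ) ^ 3 ≤ exp 1 ^ 3 := pow_le_pow_left₀ (by norm_num) (by linarith) 3
    norm_num at h4
    linarith
  have haη : exp (v + η) ≤ a * (1 + 2 * η) := by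
    rw [exp_add]
    have h1 : exp η ≤ 1 / (1 - η) := by
      rw [le_div_iff₀ (by linarith)]
      have := add_one_le_exp (-η)
      have h2 : exp η * exp (-η) = 1 := by rw [← exp_add]; simp
      nlinarith [exp_pos η]
    have h3 : 1 / (1 - η) ≤ 1 + 2 * η := by
      rw [div_le_iff₀ (by linarith)]; nlinarith
    gcongr
    linarith
  set n := ⌈a⌉₊ - 1 with hn
  set N := ⌊exp (v + η)⌋₊ with hN
  have hceil := Nat.ceil_lt_add_one ha0.le
  have hceil2 := Nat.le_ceil a
  have hc1 : 1 ≤ ⌈a⌉₊ := by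
    have : (0 : ℝ) < ⌈a⌉₊ := by linarith
    exact_mod_cast this
  have hnr : (n : ℝ) = ⌈a⌉₊ - 1 := by rw [hn]; push_cast [hc1]; ring
  have hNle : (N : ℝ) ≤ exp (v + η) := Nat.floor_le (exp_pos _).le
  have haη' : a ≤ exp (v + η) := exp_le_exp.2 (by linarith)
  have hNge : exp (v + η) < N + 1 := Nat.lt_floor_add_one _
  have hexp' : exp (v + η) ≥ a * (1 + η) := by
    rw [exp_add]; gcongr; linarith [add_one_le_exp η]
  have haη1 : 1 ≤ a * η := by rwa [div_le_iff₀ hη] at hvη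
  have hnN : n ≤ N := by
    have : (n : ℝ) < N + 1 := by linarith
    exact Nat.lt_succ_iff.1 (by exact_mod_cast this)
  have hN2 : N ≤ 2 * n := by
    have h1 : (N : ℝ) < 2 * n + 3 := by nlinarith
    have h2 : a * (1 + 2 * η) ≤ 2 * a := by nlinarith
    have h3 : (N : ℝ) ≤ a * (1 + 2 * η) := hNle.trans haη
    by_contra! hcon
    have h4 : (2 * n + 1 : ℝ) ≤ N := by exact_mod_cast hcon
    have h5 : exp η ≤ 1.66 := by
      have : exp η ≤ exp (1 / 2) := exp_le_exp.2 hη1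
      have h6 : exp (1 / 2 : ℝ) ^ 2 = exp 1 := by rw [← exp_nat_mul]; norm_num
      have h7 := exp_one_lt_d9
      nlinarith [exp_pos (1 / 2 : ℝ)]
    have h6 : exp (v + η) ≤ a * 1.66 := by rw [exp_add]; gcongr
    linarith
  have hn0 : 0 < n := by
    have : (0 : ℝ) < n := by linarith
    exact_mod_cast this
  have hmain := sum_log_prime_Ioc_le hn0 hnN hN2
  have hsub : P.filter (fun p : ℕ => v ≤ log (p : ℕ) ∧ log p ≤ v + η) ⊆
      (Finset.Ioc n N).filter Nat.Prime := by
    intro p hp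
    obtain ⟨hp1, hp2, hp3⟩ := Finset.mem_filter.1 hp
    have hpp := hP p hp1
    have hp0 : (0 : ℝ) < p := by exact_mod_cast hpp.pos
    refine Finset.mem_filter.2 ⟨Finset.mem_Ioc.2 ⟨?_, ?_⟩, hpp⟩
    · have h1 : a ≤ p := by rwa [ha, ← le_log_iff_exp_le hp0]
      have h2 : ⌈a⌉₊ ≤ p := Nat.ceil_le.2 h1
      omega
    · exact Nat.le_floor ((log_le_iff_le_exp hp0).1 hp3)
  calc ∑ p ∈ P with v ≤ log (p : ℕ) ∧ log p ≤ v + η, (1 : ℝ) / p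
      ≤ ∑ p ∈ P with v ≤ log (p : ℕ) ∧ log p ≤ v + η, log p / (a * v) := by
        refine Finset.sum_le_sum fun p hp => ?_
        obtain ⟨hp1, hp2, hp3⟩ := Finset.mem_filter.1 hp
        have hp0 : (0 : ℝ) < p := by exact_mod_cast (hP p hp1).pos
        have h1 : a ≤ p := by rwa [ha, ← le_log_iff_exp_le hp0]
        rw [div_le_div_iff₀ hp0 (by positivity), one_mul, mul_comm]
        gcongr
    _ ≤ ∑ p ∈ Finset.Ioc n N with p.Prime, log p / (a * v) := by
        refine Finset.sum_le_sum_of_subset_of_nonneg hsub fun p hp _ => ?_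
        have := log_natCast_nonneg p
        positivity
    _ ≤ 2 * √(((N : ℝ) - n) * N) / (a * v) := by
        rw [← Finset.sum_div]; gcongr
    _ ≤ 5 * √η / v := by
        have h1 : √(((N : ℝ) - n) * N) ≤ 5 / 2 * a * √η := by
          have e : 5 / 2 * a * √η = √((5 / 2 * a) ^ 2 * η) := by
            rw [sqrt_mul (by positivity), sqrt_sq (by positivity)]
          rw [e]
          apply sqrt_le_sqrt
          have h2 : (N : ℝ) - n ≤ 3 * (a * η) := by nlinarith
          have h3 : (N : ℝ) ≤ 2 * a := by nlinarith
          have h4 : (0 : ℝ) ≤ N - n := by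
            have : (n : ℝ) ≤ N := by exact_mod_cast hnN
            linarith
          calc ((N : ℝ) - n) * N ≤ 3 * (a * η) * (2 * a) := by gcongr
            _ ≤ _ := by nlinarith [mul_pos ha0 (mul_pos ha0 hη)]
        rw [div_le_div_iff₀ (by positivity) (by positivity)]
        have : 2 * √(((N : ℝ) - n) * N) * v ≤ 2 * (5 / 2 * a * √η) * v := by gcongr
        linarith

lemma sum_inv_prime_cover {v : ℝ} (hv : 3 ≤ v) (P : Finset ℕ) (hP : ∀ p ∈ P, p.Prime) (J : ℕ) :
    ∑ p ∈ P with v ≤ log (p : ℕ) ∧ log p ≤ v + J / 2, (1 : ℝ) / p ≤ (J + 1) * (5 / v) := by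
  have hshort : ∀ u : ℝ, v ≤ u → ∑ p ∈ P with u ≤ log (p : ℕ) ∧ log p ≤ u + 1 / 2, (1 : ℝ) / p ≤
      5 / v := by
    intro u hu
    refine (sum_inv_prime_short (by norm_num) le_rfl (by linarith) ?_ P hP).trans ?_
    · have := add_one_le_exp u; norm_num; linarith
    · have : √(1 / 2 : ℝ) ≤ 1 := sqrt_le_one.2 (by norm_num)
      gcongr
      linarith
  induction J with
  | zero =>
    refine (Finset.sum_le_sum_of_subset_of_nonneg ?_ fun _ _ _ => by positivity).trans
      ((hshort v le_rfl).trans (by simp))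
    intro p hp
    simp only [Finset.mem_filter] at hp ⊢
    push_cast at hp
    exact ⟨hp.1, hp.2.1, by linarith [hp.2.2]⟩
  | succ J ih =>
    have hsub : P.filter (fun p : ℕ => v ≤ log (p : ℕ) ∧ log p ≤ v + ((J + 1 : ℕ) : ℝ) / 2) ⊆
        P.filter (fun p : ℕ => v ≤ log (p : ℕ) ∧ log p ≤ v + J / 2) ∪
        P.filter (fun p : ℕ => v + J / 2 ≤ log (p : ℕ) ∧ log p ≤ v + J / 2 + 1 / 2) := by
      intro p hp
      simp only [Finset.mem_filter, Finset.mem_union] at hp ⊢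
      push_cast at hp
      rcases le_total (log p) (v + J / 2) with h | h
      · exact Or.inl ⟨hp.1, hp.2.1, h⟩
      · exact Or.inr ⟨hp.1, h, by linarith [hp.2.2]⟩
    refine (Finset.sum_le_sum_of_subset_of_nonneg hsub fun _ _ _ => by positivity).trans ?_
    have h1 := Finset.sum_union_inter (f := fun p : ℕ => (1 : ℝ) / p)
      (s₁ := P.filter (fun p : ℕ => v ≤ log (p : ℕ) ∧ log p ≤ v + J / 2))
      (s₂ := P.filter (fun p : ℕ => v + J / 2 ≤ log (p : ℕ) ∧ log p ≤ v + J / 2 + 1 / 2))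
    have h2 : 0 ≤ ∑ p ∈ P.filter (fun p : ℕ => v ≤ log (p : ℕ) ∧ log p ≤ v + J / 2) ∩
        P.filter (fun p : ℕ => v + J / 2 ≤ log (p : ℕ) ∧ log p ≤ v + J / 2 + 1 / 2),
        (1 : ℝ) / p := Finset.sum_nonneg fun _ _ => by positivity
    have h3 := hshort (v + J / 2) (by linarith [Nat.cast_nonneg (α := ℝ) J])
    push_cast
    linarith

lemma exists_spreadOut_primes : ∃ C : ℝ, 1 ≤ C ∧ ∀ h₀ : ℝ, 0 < h₀ → ∃ Y₀ : ℝ, ∀ Y, Y₀ ≤ Y →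
    ∀ (P : Finset ℕ) (w : ℕ → ℝ), (∀ p ∈ P, p.Prime) → (∀ p ∈ P, Y ≤ log p ∧ log p ≤ 2 * Y) →
      (∀ p ∈ P, 0 ≤ w p ∧ w p ≤ 1 / p) →
      SpreadOut P w (fun p => 6 * π * log p) (6 * π * Y) C h₀ := by
  have hpi := pi_gt_three
  have hpi4 := pi_lt_d2
  refine ⟨30, by norm_num, fun h₀ hh₀ => ⟨max 3 (6 * π / h₀), fun Y hY P w hP hlog hw => ?_⟩⟩
  have hY3 : 3 ≤ Y := (le_max_left _ _).trans hY
  have hYh : 6 * π / h₀ ≤ Y := (le_max_right _ _).trans hY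
  refine ⟨fun p hp => (hw p hp).1, fun p hp => ?_, fun p hp => ?_, fun u h hh => ?_⟩
  · have := (hlog p hp).1
    gcongr
  · have := mul_le_mul_of_nonneg_left (hlog p hp).2 (show 0 ≤ 6 * π by positivity)
    linarith
  set v := max (u / (6 * π)) Y with hv
  set η := h / (6 * π) with hη
  have hh0 : 0 < h := by linarith
  have hη0 : 0 < η := by positivity
  have hvY : Y ≤ v := le_max_right _ _
  have hsub : P.filter (fun p : ℕ => u ≤ 6 * π * log p ∧ 6 * π * log p ≤ u + h) ⊆
      P.filter (fun p : ℕ => v ≤ log (p : ℕ) ∧ log p ≤ v + η) := by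
    intro p hp
    simp only [Finset.mem_filter] at hp ⊢
    obtain ⟨hp1, hp2, hp3⟩ := hp
    have h1 : u / (6 * π) ≤ log p := by rw [div_le_iff₀ (by positivity)]; linarith
    refine ⟨hp1, max_le h1 (hlog p hp1).1, ?_⟩
    have h2 : log p ≤ u / (6 * π) + η := by
      rw [hη, ← add_div, le_div_iff₀ (by positivity)]; linarith
    linarith [le_max_left (u / (6 * π)) Y]
  have hle : ∑ p ∈ P with u ≤ 6 * π * log (p : ℕ) ∧ 6 * π * log p ≤ u + h, w p ≤
      ∑ p ∈ P with v ≤ log (p : ℕ) ∧ log p ≤ v + η, (1 : ℝ) / p :=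
    (Finset.sum_le_sum fun p hp => (hw p (Finset.mem_filter.1 hp).1).2).trans
      (Finset.sum_le_sum_of_subset_of_nonneg hsub fun _ _ _ => by positivity)
  refine hle.trans ?_
  have hs0 : 0 ≤ √h := sqrt_nonneg h
  rcases le_or_gt η (1 / 2) with h1 | h1
  · have h2 : 1 / η ≤ exp v := by
      have : 1 / η ≤ 6 * π / h₀ := by
        rw [hη, one_div_div]; gcongr
      linarith [add_one_le_exp v]
    refine (sum_inv_prime_short hη0 h1 (by linarith) h2 P hP).trans ?_
    have h3 : √η * (6 * π) ≤ 5 * √h := by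
      have : √h = √η * √(6 * π) := by
        rw [← sqrt_mul hη0.le, hη]; congr 1; field_simp
      rw [this]
      have h4 : √(6 * π) ≤ 5 := by
        rw [sqrt_le_left (by norm_num)]; linarith
      have h5 : √(6 * π) * √(6 * π) = 6 * π := mul_self_sqrt (by positivity)
      have h6 : 0 ≤ √η := sqrt_nonneg _
      nlinarith [mul_nonneg h6 (sqrt_nonneg (6 * π))]
    calc 5 * √η / v ≤ 5 * √η / Y := by gcongr
      _ = 5 * (√η * (6 * π)) / (6 * π * Y) := by field_simp
      _ ≤ 5 * (5 * √h) / (6 * π * Y) := by gcongr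
      _ = 25 * √h / (6 * π * Y) := by ring
      _ ≤ 30 * (√h + h) / (6 * π * Y) := by gcongr ?_ / _; linarith
  · have h2 := Nat.le_ceil (2 * η)
    have h3 := Nat.ceil_lt_add_one (show 0 ≤ 2 * η by positivity)
    have h4 := sum_inv_prime_cover (show 3 ≤ v by linarith) P hP ⌈2 * η⌉₊
    have h5 : ∑ p ∈ P with v ≤ log (p : ℕ) ∧ log p ≤ v + η, (1 : ℝ) / p ≤
        ∑ p ∈ P with v ≤ log (p : ℕ) ∧ log p ≤ v + (⌈2 * η⌉₊ : ℝ) / 2, (1 : ℝ) / p := by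
      refine Finset.sum_le_sum_of_subset_of_nonneg ?_ fun _ _ _ => by positivity
      intro p hp
      simp only [Finset.mem_filter] at hp ⊢
      exact ⟨hp.1, hp.2.1, by linarith [hp.2.2]⟩
    calc _ ≤ (⌈2 * η⌉₊ + 1) * (5 / v) := h5.trans h4
      _ ≤ (6 * η) * (5 / Y) := by gcongr; linarith
      _ = 30 * h / (6 * π * Y) := by rw [hη]; field_simp; norm_num
      _ ≤ _ := by gcongr ?_ / _; linarith

lemma exists_prod_one_add_inv_ge : ∃ c : ℝ, 0 < c ∧ ∀ N : ℕ,
    c * log (N + 1) ≤ ∏ p ∈ (N + 1).primesBelow, (1 + (1 : ℝ) / p) := by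
  have hS : Summable (fun m : ℕ => 1 / (m : ℝ) ^ 2) := summable_one_div_nat_pow.2 (by norm_num)
  set S := ∑' m : ℕ, 1 / (m : ℝ) ^ 2 with hSdef
  have hS0 : 0 < S := hS.tsum_pos (fun _ => by positivity) 1 (by norm_num)
  refine ⟨1 / S, by positivity, fun N => ?_⟩
  rw [one_div, inv_mul_le_iff₀ hS0]
  have h1 := log_add_one_le_harmonic N
  push_cast at h1
  refine h1.trans ?_
  have h2 : (harmonic N : ℝ) = ∑ n ∈ Nat.smoothNumbersUpTo N (N + 1), (1 : ℝ) / n := by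
    rw [harmonic_eq_sum_Icc]
    push_cast
    simp_rw [one_div]
    refine Finset.sum_congr ?_ fun _ _ => rfl
    ext n
    rw [Nat.mem_smoothNumbersUpTo, Finset.mem_Icc]
    constructor
    · rintro ⟨h, h'⟩
      exact ⟨h', Nat.mem_smoothNumbers_of_lt (by omega) (by omega)⟩
    · rintro ⟨h, h'⟩
      exact ⟨Nat.pos_of_ne_zero (Nat.ne_zero_of_mem_smoothNumbers h'), h⟩
  rw [h2]
  calc ∑ n ∈ Nat.smoothNumbersUpTo N (N + 1), (1 : ℝ) / n
      ≤ ∑ n ∈ Finset.image (fun q : Finset ℕ × ℕ => q.2 ^ 2 * (q.1.prod id))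
        ((N + 1).primesBelow.powerset ×ˢ (Finset.range (N.sqrt + 1)).erase 0), (1 : ℝ) / n :=
        Finset.sum_le_sum_of_subset_of_nonneg (Nat.smoothNumbersUpTo_subset_image N (N + 1))
          fun _ _ _ => by positivity
    _ ≤ ∑ q ∈ (N + 1).primesBelow.powerset ×ˢ (Finset.range (N.sqrt + 1)).erase 0,
        (1 : ℝ) / ((q.2 ^ 2 * (q.1.prod id) : ℕ) : ℝ) :=
        Finset.sum_image_le_of_nonneg fun _ _ => by positivity
    _ = (∑ m ∈ (Finset.range (N.sqrt + 1)).erase 0, 1 / (m : ℝ) ^ 2) *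
        ∏ p ∈ (N + 1).primesBelow, (1 + (1 : ℝ) / p) := by
        rw [Finset.prod_one_add, Finset.sum_product, Finset.sum_mul_sum, Finset.sum_comm]
        refine Finset.sum_congr rfl fun m _ => Finset.sum_congr rfl fun s _ => ?_
        simp [Finset.prod_inv_distrib, mul_comm]
    _ ≤ S * ∏ p ∈ (N + 1).primesBelow, (1 + (1 : ℝ) / p) := by
        gcongr
        exact hS.sum_le_tsum _ fun _ _ => by positivity

lemma sum_log_div_prime_le (n : ℕ) (hn : 0 < n) :
    ∑ p ∈ (n + 1).primesBelow, log p / p ≤ 2 * log n := by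
  have hdvd : ∏ p ∈ (n + 1).primesBelow, p ^ (n / p) ∣ n.factorial := by
    refine Finset.prod_dvd_of_isRelPrime ?_ (fun p hp => ?_)
    · intro p hp q hq hpq
      exact Nat.coprime_iff_isRelPrime.1 ((Nat.coprime_primes (Nat.prime_of_mem_primesBelow hp)
        (Nat.prime_of_mem_primesBelow hq)).2 hpq |>.pow _ _)
    · have hp' := Nat.prime_of_mem_primesBelow hp
      rw [hp'.pow_dvd_factorial_iff (b := Nat.log p n + 1) (Nat.lt_succ_self _)]
      by_cases h : 1 ≤ Nat.log p n
      · have := Finset.single_le_sum (f := fun i => n / p ^ i) (s := Finset.Ico 1 (Nat.log p n + 1))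
          (fun _ _ => Nat.zero_le _) (Finset.mem_Ico.2 ⟨le_rfl, by omega⟩)
        simpa using this
      · have h1 : Nat.log p n = 0 := by omega
        rw [Nat.log_eq_zero_iff] at h1
        rcases h1 with h1 | h1
        · rw [Nat.div_eq_of_lt h1]; simp
        · have := hp'.two_le; omega
  have hle := Nat.le_of_dvd n.factorial_pos hdvd
  have hle2 := hle.trans (Nat.factorial_le_pow n)
  have hn0 : (0 : ℝ) < n := by exact_mod_cast hn
  have hlog : ∑ p ∈ (n + 1).primesBelow, (n / p : ℕ) * log p ≤ n * log n := by
    rw [← log_pow, show ∑ p ∈ (n + 1).primesBelow, ((n / p : ℕ) : ℝ) * log p =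
      ∑ p ∈ (n + 1).primesBelow, log ((p : ℝ) ^ (n / p)) from
        Finset.sum_congr rfl fun _ _ => (log_pow _ _).symm, ← log_prod]
    · apply log_le_log
      · exact Finset.prod_pos fun p hp => by
          have := (Nat.prime_of_mem_primesBelow hp).pos; positivity
      · exact_mod_cast hle2
    · intro p hp
      have := (Nat.prime_of_mem_primesBelow hp).pos; positivity
  have hterm : ∀ p ∈ (n + 1).primesBelow, n / 2 * (log p / p) ≤ (n / p : ℕ) * log p := by
    intro p hp
    have hp0 : (0 : ℝ) < p := by exact_mod_cast (Nat.prime_of_mem_primesBelow hp).pos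
    have hpn : p ≤ n := Nat.lt_succ_iff.1 (Nat.lt_of_mem_primesBelow hp)
    have h1 : 1 ≤ n / p := Nat.div_pos hpn (Nat.prime_of_mem_primesBelow hp).pos
    have h2 : n < p * (n / p + 1) := Nat.lt_mul_div_succ n (Nat.prime_of_mem_primesBelow hp).pos
    have h1' : (1 : ℝ) ≤ (n / p : ℕ) := by exact_mod_cast h1
    have h2' : (n : ℝ) < p * ((n / p : ℕ) + 1) := by exact_mod_cast h2
    have h3 : (n : ℝ) / 2 / p ≤ (n / p : ℕ) := by
      rw [div_div, div_le_iff₀ (by positivity)]; nlinarith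
    calc n / 2 * (log p / p) = (n : ℝ) / 2 / p * log p := by ring
      _ ≤ _ := mul_le_mul_of_nonneg_right h3 (log_natCast_nonneg p)
  have := (Finset.sum_le_sum hterm).trans hlog
  rw [← Finset.mul_sum] at this
  have h3 : (n : ℝ) / 2 * ∑ p ∈ (n + 1).primesBelow, log p / p ≤ n / 2 * (2 * log n) := by linarith
  exact le_of_mul_le_mul_left h3 (by positivity)

lemma smoothCount_le_four_mul {P : Finset ℕ} {w : ℕ → ℝ} (x : ℕ → ℝ) (hw : ∀ p ∈ P, 0 ≤ w p)
    (k : ℕ) (τ : ℝ) : smoothCount P w x k τ ≤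
      4 * ∑ q ∈ Fintype.piFinset (fun _ : Fin k => P) with |∑ i, x (q i) - τ| ≤ 2 * π,
        ∏ i, w (q i) := by
  rw [smoothCount, Finset.mul_sum, Finset.sum_filter]
  refine Finset.sum_le_sum fun q hq => ?_
  have h0 : 0 ≤ ∏ i, w (q i) := Finset.prod_nonneg fun i _ => hw _ (Fintype.mem_piFinset.1 hq i)
  split_ifs with h
  · rw [mul_comm]
    exact mul_le_mul_of_nonneg_right ((abs_le.1 (abs_selbergKernel_le _)).2) h0
  · exact mul_nonpos_of_nonneg_of_nonpos h0 (selbergKernel_nonpos (not_le.1 h))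

lemma sum_tuples_near_ge {P Q : Finset ℕ} {w x : ℕ → ℝ} {k r : ℕ} {τ v A Z : ℝ}
    (hw : ∀ p ∈ P, 0 ≤ w p) (hQ : Q ⊆ P)
    (hwin : ∀ σ, |σ - τ| ≤ Z → A ≤ smoothCount P w x k σ)
    (hv : ∀ s ∈ Fintype.piFinset (fun _ : Fin r => Q), |v - ∑ i, x (s i) - τ| ≤ Z) :
    (∑ p ∈ Q, w p) ^ r * A ≤
      4 * ∑ t ∈ Fintype.piFinset (fun _ : Fin k ⊕ Fin r => P) with |∑ i, x (t i) - v| ≤ 2 * π,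
        ∏ i, w (t i) := by
  have e : ∑ t ∈ Fintype.piFinset (fun _ : Fin k ⊕ Fin r => P) with |∑ i, x (t i) - v| ≤ 2 * π,
        ∏ i, w (t i) = ∑ s ∈ Fintype.piFinset (fun _ : Fin r => P),
          ∑ q ∈ Fintype.piFinset (fun _ : Fin k => P) with
            |∑ i, x (q i) - (v - ∑ i, x (s i))| ≤ 2 * π, (∏ i, w (s i)) * ∏ i, w (q i) := by
    simp_rw [Finset.sum_filter]
    rw [← Finset.sum_product', Finset.sum_bij' (fun t _ => (t ∘ Sum.inr, t ∘ Sum.inl))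
      (fun y _ => Sum.elim y.2 y.1)]
    · intro t ht
      rw [Fintype.mem_piFinset] at ht
      simp [ht]
    · rintro ⟨y1, y2⟩ hy
      simp only [Finset.mem_product, Fintype.mem_piFinset] at hy ⊢
      rintro (i | i)
      · exact hy.2 i
      · exact hy.1 i
    · intro t _
      exact Sum.elim_comp_inl_inr t
    · rintro ⟨y1, y2⟩ _
      simp
    · intro t _
      simp only [Fintype.sum_sum_type, Fintype.prod_sum_type, Function.comp]
      rw [mul_comm (∏ i, w (t (Sum.inl i))), show ∑ i, x (t (Sum.inl i)) + ∑ i, x (t (Sum.inr i)) - v =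
        ∑ i, x (t (Sum.inl i)) - (v - ∑ i, x (t (Sum.inr i))) by ring]
  have hmono : Fintype.piFinset (fun _ : Fin r => Q) ⊆ Fintype.piFinset (fun _ : Fin r => P) :=
    Fintype.piFinset_subset _ _ fun _ => hQ
  rw [e, Finset.sum_pow', Finset.sum_mul, Finset.mul_sum]
  refine le_trans (Finset.sum_le_sum fun s hs => ?_)
    (Finset.sum_le_sum_of_subset_of_nonneg hmono fun s hs _ => ?_)
  · have h0 : 0 ≤ ∏ i, w (s i) :=
      Finset.prod_nonneg fun i _ => hw _ (hQ (Fintype.mem_piFinset.1 hs i))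
    rw [← Finset.mul_sum, mul_left_comm]
    exact mul_le_mul_of_nonneg_left ((hwin _ (hv s hs)).trans (smoothCount_le_four_mul x hw k _)) h0
  · rw [Fintype.mem_piFinset] at hs
    refine mul_nonneg (by norm_num) (Finset.sum_nonneg fun q hq => ?_)
    have hq' := Fintype.mem_piFinset.1 (Finset.mem_filter.1 hq).1
    exact mul_nonneg (Finset.prod_nonneg fun i _ => hw _ (hs i))
      (Finset.prod_nonneg fun i _ => hw _ (hq' i))

/-- Tuples with a repeated entry carry little weight. -/
lemma sum_not_injective_le {ι : Type*} [Fintype ι] [DecidableEq ι] {P : Finset ℕ} {w : ℕ → ℝ}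
    {η M : ℝ} (hw : ∀ p ∈ P, 0 ≤ w p) (hη0 : 0 ≤ η)
    (hη : ∀ p ∈ P, w p ≤ η) (hM : 1 ≤ M)
    (hWM : ∑ p ∈ P, w p ≤ M) :
    ∑ t ∈ Fintype.piFinset (fun _ : ι => P) with ¬ Function.Injective t, ∏ i, w (t i) ≤
      (Fintype.card ι) ^ 2 * (η * M ^ (Fintype.card ι + 1)) := by
  set W := ∑ p ∈ P, w p with hW
  have hW0 : 0 ≤ W := Finset.sum_nonneg hw
  have hpair : ∀ a b : ι, a ≠ b →
      ∑ t ∈ Fintype.piFinset (fun _ : ι => P) with t a = t b, ∏ i, w (t i) ≤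
        η * M ^ (Fintype.card ι + 1) := by
    intro a b hab
    have h1 : ∑ t ∈ Fintype.piFinset (fun _ : ι => P) with t a = t b, ∏ i, w (t i) ≤
        ∑ p ∈ P, ∑ t ∈ Fintype.piFinset (fun i : ι => if i = a ∨ i = b then {p} else P),
          ∏ i, w (t i) := by
      rw [← Finset.sum_fiberwise_of_maps_to (s := (Fintype.piFinset (fun _ : ι => P)).filter
        (fun t => t a = t b)) (t := P) (g := fun t => t a)
        (fun t ht => Fintype.mem_piFinset.1 (Finset.mem_filter.1 ht).1 a)]
      refine Finset.sum_le_sum fun p hp => ?_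
      refine Finset.sum_le_sum_of_subset_of_nonneg ?_ fun t ht _ => ?_
      · intro t ht
        simp only [Finset.mem_filter, Fintype.mem_piFinset] at ht ⊢
        intro i
        split_ifs with h
        · rcases h with rfl | rfl
          · simpa using ht.2
          · simpa [← ht.1.2] using ht.2
        · exact ht.1.1 i
      · rw [Fintype.mem_piFinset] at ht
        refine Finset.prod_nonneg fun i _ => hw _ ?_
        have := ht i
        split_ifs at this with h
        · rw [Finset.mem_singleton.1 this]; exact hp
        · exact this
    have h2 : ∀ p ∈ P, ∑ t ∈ Fintype.piFinset (fun i : ι => if i = a ∨ i = b then {p} else P),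
        ∏ i, w (t i) ≤ w p * (η * M ^ Fintype.card ι) := by
      intro p hp
      rw [← Finset.prod_univ_sum]
      have h3 : ∀ i, ∑ j ∈ (if i = a ∨ i = b then {p} else P), w j =
          if i = a ∨ i = b then w p else W := by
        intro i; split_ifs <;> simp [hW]
      simp_rw [h3]
      rw [Finset.prod_ite, Finset.prod_const, Finset.prod_const]
      have h4 : (Finset.univ.filter (fun i => i = a ∨ i = b)).card = 2 := by
        rw [show Finset.univ.filter (fun i => i = a ∨ i = b) = {a, b} by ext; simp]
        exact Finset.card_pair hab
      rw [h4, sq, mul_assoc]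
      have h5 : W ^ (Finset.univ.filter (fun i => ¬ (i = a ∨ i = b))).card ≤ M ^ Fintype.card ι :=
        (pow_le_pow_left₀ hW0 hWM _).trans (pow_le_pow_right₀ hM (Finset.card_le_univ _))
      exact mul_le_mul_of_nonneg_left (mul_le_mul (hη p hp) h5 (by positivity)
        ((hw p hp).trans (hη p hp))) (hw p hp)
    refine h1.trans ((Finset.sum_le_sum h2).trans ?_)
    rw [← Finset.sum_mul]
    calc W * (η * M ^ Fintype.card ι) ≤ M * (η * M ^ Fintype.card ι) := by gcongr
      _ = _ := by ring
  have h6 : ∑ t ∈ Fintype.piFinset (fun _ : ι => P) with ¬ Function.Injective t, ∏ i, w (t i) ≤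
      ∑ y ∈ (Finset.univ : Finset ι).offDiag,
        ∑ t ∈ Fintype.piFinset (fun _ : ι => P) with t y.1 = t y.2, ∏ i, w (t i) := by
    simp_rw [Finset.sum_filter]
    rw [Finset.sum_comm]
    refine Finset.sum_le_sum fun t ht => ?_
    have h0 : 0 ≤ ∏ i, w (t i) :=
      Finset.prod_nonneg fun i _ => hw _ (Fintype.mem_piFinset.1 ht i)
    have h7 : ∀ y ∈ (Finset.univ : Finset ι).offDiag,
        0 ≤ if t y.1 = t y.2 then ∏ i, w (t i) else 0 := by
      intro y _; split_ifs <;> simp [h0]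
    split_ifs with h
    swap
    · rw [Function.not_injective_iff] at h
      obtain ⟨a, b, hab, hne⟩ := h
      refine le_trans ?_ (Finset.single_le_sum h7 (a := (a, b)) (by simpa using hne))
      simp [hab]
    · exact Finset.sum_nonneg h7
  refine h6.trans ((Finset.sum_le_card_nsmul _ _ _ fun y hy =>
    hpair y.1 y.2 (Finset.mem_offDiag.1 hy).2.2).trans ?_)
  rw [nsmul_eq_mul]
  refine mul_le_mul_of_nonneg_right ?_ (by positivity)
  have : (Finset.univ : Finset ι).offDiag.card ≤ Fintype.card ι ^ 2 := by
    rw [Finset.offDiag_card, sq, Finset.card_univ]; exact Nat.sub_le _ _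
  exact_mod_cast this

/-- From weighted tuples of distinct primes to their products. -/
lemma sum_injective_tuples_le {ι : Type*} [Fintype ι] [DecidableEq ι] {P : Finset ℕ} {f : ℕ → ℝ}
    (hP : ∀ p ∈ P, p.Prime) (hf0 : ∀ n, 0 ≤ f n) (hf1 : f 1 = 1)
    (hmul : ∀ m n : ℕ, Nat.Coprime m n → f (m * n) = f m * f n) {y : ℝ} (S : Finset ℕ)
    (T : Finset (ι → ℕ)) (hT : ∀ t ∈ T, (∀ i, t i ∈ P) ∧ Function.Injective t)
    (hTy : ∀ t ∈ T, y ≤ ∑ i, log (t i)) (hTS : ∀ t ∈ T, ∏ i, t i ∈ S) :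
    exp y * ∑ t ∈ T, ∏ i, (f (t i) / t i) ≤
      (Fintype.card ι : ℝ) ^ Fintype.card ι * ∑ n ∈ S, f n := by
  have hprime : ∀ t ∈ T, ∀ i, (t i).Prime := fun t ht i => hP _ ((hT t ht).1 i)
  have hfprod : ∀ t ∈ T, ∀ s : Finset ι, f (∏ i ∈ s, t i) = ∏ i ∈ s, f (t i) := by
    intro t ht s
    induction s using Finset.induction_on with
    | empty => simpa using hf1
    | insert a s ha ih =>
      rw [Finset.prod_insert ha, Finset.prod_insert ha, hmul, ih]
      refine Nat.Coprime.prod_right fun i hi => ?_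
      refine (Nat.coprime_primes (hprime t ht a) (hprime t ht i)).2 fun h => ha ?_
      rwa [(hT t ht).2 h]
  have hterm : ∀ t ∈ T, exp y * ∏ i, (f (t i) / t i) ≤ f (∏ i, t i) := by
    intro t ht
    have hpos : ∀ i, (0 : ℝ) < t i := fun i => by exact_mod_cast (hprime t ht i).pos
    have hprod : (0 : ℝ) < ∏ i, (t i : ℝ) := Finset.prod_pos fun i _ => hpos i
    have h1 : exp y ≤ ∏ i, (t i : ℝ) := by
      rw [← le_log_iff_exp_le hprod, log_prod fun i _ => (hpos i).ne']
      exact hTy t ht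
    rw [Finset.prod_div_distrib, ← hfprod t ht, ← mul_div_assoc, div_le_iff₀ hprod, mul_comm]
    exact mul_le_mul_of_nonneg_left h1 (hf0 _)
  have hfiber : ∀ n ∈ S, ∑ t ∈ T with ∏ i, t i = n, f (∏ i, t i) ≤
      (Fintype.card ι : ℝ) ^ Fintype.card ι * f n := by
    intro n _
    have hsub : (T.filter (fun t => ∏ i, t i = n)).card ≤ Fintype.card ι ^ Fintype.card ι := by
      rcases (T.filter (fun t => ∏ i, t i = n)).eq_empty_or_nonempty with h | ⟨t₀, ht₀⟩
      · rw [h]; simp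
      obtain ⟨ht₀T, ht₀n⟩ := Finset.mem_filter.1 ht₀
      have hn0 : n ≠ 0 := by
        rw [← ht₀n]; exact Finset.prod_ne_zero_iff.2 fun i _ => (hprime t₀ ht₀T i).ne_zero
      have hcard : n.primeFactors.card ≤ Fintype.card ι := by
        rw [← ht₀n, ← Finset.prod_image (f := fun p => p) (s := Finset.univ) (g := t₀)
          (fun a _ b _ h => (hT t₀ ht₀T).2 h), Nat.primeFactors_prod]
        · exact Finset.card_image_le
        · intro p hp
          obtain ⟨i, -, rfl⟩ := Finset.mem_image.1 hp
          exact hprime t₀ ht₀T i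
      calc _ ≤ (Fintype.piFinset (fun _ : ι => n.primeFactors)).card := by
            refine Finset.card_le_card fun t ht => ?_
            obtain ⟨htT, htn⟩ := Finset.mem_filter.1 ht
            rw [Fintype.mem_piFinset]
            intro i
            rw [Nat.mem_primeFactors]
            exact ⟨hprime t htT i, htn ▸ Finset.dvd_prod_of_mem _ (Finset.mem_univ i), hn0⟩
        _ = n.primeFactors.card ^ Fintype.card ι := by simp [Fintype.card_piFinset]
        _ ≤ _ := Nat.pow_le_pow_left hcard _
    calc ∑ t ∈ T with ∏ i, t i = n, f (∏ i, t i) = ∑ t ∈ T with ∏ i, t i = n, f n :=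
          Finset.sum_congr rfl fun t ht => by rw [(Finset.mem_filter.1 ht).2]
      _ = (T.filter (fun t => ∏ i, t i = n)).card * f n := by simp
      _ ≤ _ := by
        refine mul_le_mul_of_nonneg_right ?_ (hf0 n)
        exact_mod_cast hsub
  rw [Finset.mul_sum, Finset.mul_sum]
  refine (Finset.sum_le_sum hterm).trans ?_
  rw [← Finset.sum_fiberwise_of_maps_to (g := fun t : ι → ℕ => ∏ i, t i) (t := S) hTS]
  exact Finset.sum_le_sum hfiber

lemma exists_cell {P : Finset ℕ} {w : ℕ → ℝ} {Y : ℝ} (hY : 0 < Y) {R : ℕ} (hR : 0 < R)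
    (hlog : ∀ p ∈ P, Y ≤ log p ∧ log p ≤ 2 * Y) :
    ∃ b, Y ≤ b ∧ b ≤ 2 * Y ∧ ∃ Q ⊆ P, (∀ p ∈ Q, b ≤ log p ∧ log p ≤ b + Y / R) ∧
      (∑ p ∈ P, w p) / (R + 1) ≤ ∑ p ∈ Q, w p := by
  have hR0 : (0 : ℝ) < R := by exact_mod_cast hR
  have hmaps : ∀ p ∈ P, ⌊(log p - Y) / (Y / R)⌋₊ ∈ Finset.range (R + 1) := by
    intro p hp
    rw [Finset.mem_range, Nat.lt_succ_iff]
    apply Nat.floor_le_of_le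
    rw [div_le_iff₀ (by positivity), mul_div_cancel₀ _ hR0.ne']
    linarith [(hlog p hp).2]
  obtain ⟨j, hj, hsum⟩ := Finset.exists_le_sum_fiber_of_maps_to_of_nsmul_le_sum (w := w)
    (b := (∑ p ∈ P, w p) / (R + 1)) hmaps (by simp) (by
      rw [Finset.card_range, nsmul_eq_mul]; push_cast
      rw [mul_div_cancel₀ _ (by positivity)])
  have hjR : (j : ℝ) ≤ R := by exact_mod_cast Nat.lt_succ_iff.1 (Finset.mem_range.1 hj)
  refine ⟨Y + j * (Y / R), ?_, ?_, _, Finset.filter_subset _ _, fun p hp => ?_, hsum⟩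
  · have : 0 ≤ j * (Y / R) := by positivity
    linarith
  · have : j * (Y / R) ≤ R * (Y / R) := by gcongr
    rw [mul_div_cancel₀ _ hR0.ne'] at this
    linarith
  · obtain ⟨hp1, hp2⟩ := Finset.mem_filter.1 hp
    have h0 : 0 ≤ (log p - Y) / (Y / R) :=
      div_nonneg (by linarith [(hlog p hp1).1]) (by positivity)
    have h1 := Nat.floor_le h0
    have h2 := Nat.lt_floor_add_one ((log p - Y) / (Y / R))
    rw [hp2, le_div_iff₀ (by positivity)] at h1
    rw [hp2, div_lt_iff₀ (by positivity)] at h2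
    constructor <;> linarith

set_option maxHeartbeats 1000000 in
/-- If the primes with `log p ∈ [L / 2 ^ (i + 3), L / 2 ^ (i + 2)]` carry enough mass, then there
are many integers composed only of these primes near every point `exp V` with
`L / 2 ≤ V ≤ L + 1`. -/
lemma exists_sum_rough_ge : ∃ C₁ : ℝ, 0 < C₁ ∧ ∀ (i : ℕ) (W₀ : ℝ), 0 < W₀ →
    C₁ ≤ 2 ^ i * W₀ ^ 12 → ∃ c : ℝ, 0 < c ∧ ∃ L₀ : ℝ, 0 < L₀ ∧ ∀ L, L₀ ≤ L →
      ∀ f : ℕ → ℝ, (∀ n, f n ∈ Set.Icc (0 : ℝ) 1) → f 1 = 1 →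
      (∀ m n : ℕ, Nat.Coprime m n → f (m * n) = f m * f n) →
      ∀ P : Finset ℕ, (∀ p ∈ P, p.Prime) →
      (∀ p ∈ P, L / 2 ^ (i + 3) ≤ log p ∧ log p ≤ 2 * (L / 2 ^ (i + 3))) →
      W₀ ≤ ∑ p ∈ P, f p / p → ∀ V, L / 2 ≤ V → V ≤ L + 1 →
      ∀ S : Finset ℕ, (∀ n : ℕ, n ≠ 0 → (∀ p, p.Prime → p ∣ n → p ∈ P) → |log n - V| ≤ 1 / 3 →
        n ∈ S) → c * exp V / L ≤ ∑ n ∈ S, f n := by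
  obtain ⟨C, hC, hspread⟩ := exists_spreadOut_primes
  obtain ⟨C₁, hC₁, hwindow⟩ := exists_window C hC
  refine ⟨C₁, hC₁, fun i W₀ hW₀ hk => ?_⟩
  obtain ⟨k, hkdef⟩ : ∃ k : ℕ, k = 2 ^ i := ⟨_, rfl⟩
  obtain ⟨R, hRdef⟩ : ∃ R : ℕ, R = 2 ^ (i + 3) := ⟨_, rfl⟩
  obtain ⟨h₀, hh₀, hh₀1, hwin⟩ := hwindow W₀ k hW₀ (by rw [hkdef]; push_cast; exact hk)
  obtain ⟨Y₀, hY₀⟩ := hspread h₀ hh₀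
  have hk0 : (0 : ℝ) < k := by rw [hkdef]; positivity
  have hR0 : (0 : ℝ) < R := by rw [hRdef]; positivity
  have hkR : (k : ℝ) / R = 1 / 8 := by rw [hkdef, hRdef]; push_cast; rw [pow_add]; field_simp; norm_num
  have hp := pi_pos
  set μ := (min 1 (W₀ / (R + 1))) ^ R with hμ
  have hμ0 : 0 < μ := by positivity
  set g := 1 / 4 * (μ * (W₀ ^ k / (10 * (k * (6 * π / R))))) with hg
  have hg0 : 0 < g := by positivity
  obtain ⟨J, hJ⟩ : ∃ J : ℕ, J = k + R := ⟨_, rfl⟩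
  set M := 2 * C with hM
  have hM1 : 1 ≤ M := by linarith
  have hJ0 : (0 : ℝ) < J := by rw [hJ]; push_cast; positivity
  refine ⟨exp (-(1 / 3)) * (g / 2) / (J : ℝ) ^ J, by positivity,
    max (max 11 (R * Y₀)) (max R (4 * (J : ℝ) ^ 2 * M ^ (J + 1) * R ^ 2 / g)), by positivity,
    fun L hL f hf hf1 hmul P hP hlog hW V hV1 hV2 S hS => ?_⟩
  have hL11 : 11 ≤ L := (le_max_left _ _).trans ((le_max_left _ _).trans hL)
  have hLY : R * Y₀ ≤ L := (le_max_right _ _).trans ((le_max_left _ _).trans hL)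
  have hLR : R ≤ L := (le_max_left _ _).trans ((le_max_right _ _).trans hL)
  have hLg : 4 * (J : ℝ) ^ 2 * M ^ (J + 1) * R ^ 2 / g ≤ L :=
    (le_max_right _ _).trans ((le_max_right _ _).trans hL)
  have hL0 : 0 < L := by linarith
  rw [show (2 : ℝ) ^ (i + 3) = R by rw [hRdef]; push_cast; rfl] at hlog
  set Y := L / R with hY
  have hY1 : 1 ≤ Y := by rw [hY, le_div_iff₀ hR0]; linarith
  have hYY₀ : Y₀ ≤ Y := by rw [hY, le_div_iff₀ hR0]; linarith
  have hw : ∀ p ∈ P, 0 ≤ f p / p ∧ f p / p ≤ 1 / p := by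
    intro p hp
    have := hf p
    exact ⟨div_nonneg this.1 (Nat.cast_nonneg _), div_le_div_of_nonneg_right this.2
      (Nat.cast_nonneg _)⟩
  have hspr := hY₀ Y hYY₀ P (fun p => f p / p) hP hlog hw
  set W := ∑ p ∈ P, f p / p with hWdef
  have hWM : W ≤ M := by
    have h1 := hspr.mass (6 * π * Y) (6 * π * Y) (by nlinarith [pi_gt_three])
    rw [Finset.filter_true_of_mem fun p hp => ⟨hspr.ge p hp, by linarith [hspr.le p hp]⟩] at h1
    refine h1.trans ?_
    have hY6 : 1 ≤ 6 * π * Y := by nlinarith [pi_gt_three]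
    rw [div_le_iff₀ (by linarith)]
    have : √(6 * π * Y) ≤ 6 * π * Y := sqrt_le_iff.2 ⟨by linarith, by nlinarith⟩
    nlinarith
  obtain ⟨τ, hτ1, hτ2, hτ⟩ := hwin P _ _ (6 * π * Y) (by nlinarith) hspr hW
  have hkY : k * Y = L / 8 := by rw [hY, mul_div_left_comm, hkR]; ring
  have hkY' : (k : ℝ) * (6 * π * Y) = 6 * π * (L / 8) := by rw [← hkY]; ring
  set T := τ / (6 * π) with hT
  have hτT : τ = 6 * π * T := by rw [hT]; field_simp
  have hT1 : L / 8 - 1 / 3 ≤ T := by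
    rw [hT, le_div_iff₀ (by positivity)]; linarith
  have hT2 : T ≤ L / 4 + 1 / 3 := by
    rw [hT, div_le_iff₀ (by positivity)]; linarith
  obtain ⟨b, hb1, hb2, Q, hQP, hQ, hQW⟩ := exists_cell (w := fun p => f p / p) (R := R)
    (by linarith) (by rw [hRdef]; positivity) hlog
  have hb0 : 0 < b := by linarith
  have hVT : 0 ≤ V - T := by linarith
  set r := ⌊(V - T) / b⌋₊ with hr
  have hr1 : r * b ≤ V - T := by
    rw [← le_div_iff₀ hb0]; exact Nat.floor_le (by positivity)
  have hr2 : V - T < (r + 1) * b := by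
    rw [← div_lt_iff₀ hb0]; exact Nat.lt_floor_add_one _
  have hrR : r ≤ R := by
    have h1 : r * Y ≤ R * Y := by
      have e : R * Y = L := by rw [hY]; field_simp
      rw [e]
      have : r * Y ≤ r * b := by gcongr
      linarith
    exact_mod_cast le_of_mul_le_mul_right h1 (by linarith)
  have hrR' : (r : ℝ) ≤ R := by exact_mod_cast hrR
  have hmain := sum_tuples_near_ge (P := P) (Q := Q) (w := fun p => f p / p)
    (x := fun p => 6 * π * log p) (k := k) (r := r) (τ := τ) (v := 6 * π * V) (Z := 2 * (6 * π * Y))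
    (fun p hp => (hw p hp).1) hQP hτ (by
      intro s hs
      rw [Fintype.mem_piFinset] at hs
      have h1 : r * b ≤ ∑ i, log (s i) := by
        simpa using Finset.card_nsmul_le_sum Finset.univ (fun i => log (s i)) b
          fun i _ => (hQ _ (hs i)).1
      have h2 : ∑ i, log (s i) ≤ r * (b + Y / R) := by
        simpa [mul_add] using Finset.sum_le_card_nsmul Finset.univ (fun i => log (s i)) (b + Y / R)
          fun i _ => (hQ _ (hs i)).2
      have h3 : r * (Y / R) ≤ Y := by
        calc r * (Y / R) ≤ R * (Y / R) := by gcongr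
          _ = Y := by field_simp
      rw [← Finset.mul_sum, hτT, show 6 * π * V - 6 * π * ∑ i, log (s i) - 6 * π * T =
        6 * π * (V - ∑ i, log (s i) - T) by ring, abs_mul, abs_of_pos (by positivity),
        show 2 * (6 * π * Y) = 6 * π * (2 * Y) by ring]
      refine mul_le_mul_of_nonneg_left (abs_le.2 ⟨?_, ?_⟩) (by positivity)
      · linarith
      · linarith)
  set G := (Fintype.piFinset (fun _ : Fin k ⊕ Fin r => P)).filter
    (fun t => |∑ i, 6 * π * log (t i) - 6 * π * V| ≤ 2 * π) with hG
  have hGge : g / L ≤ ∑ t ∈ G, ∏ i, f (t i) / t i := by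
    have h1 : μ ≤ (∑ p ∈ Q, f p / p) ^ r := by
      have h2 : W₀ / (R + 1) ≤ ∑ p ∈ Q, f p / p := by
        refine le_trans ?_ hQW
        gcongr
      calc μ ≤ (min 1 (W₀ / (R + 1))) ^ r :=
            pow_le_pow_of_le_one (by positivity) (min_le_left _ _) hrR
        _ ≤ _ := pow_le_pow_left₀ (by positivity) ((min_le_right _ _).trans h2) _
    have h3 : W₀ ^ k / (10 * (k * (6 * π / R))) / L ≤ W ^ k / (10 * (k * (6 * π * Y))) := by
      have : W₀ ^ k / (10 * (k * (6 * π / R))) / L = W₀ ^ k / (10 * (k * (6 * π * Y))) := by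
        rw [hY]; field_simp
      rw [this]
      gcongr
    have h4 : μ * (W₀ ^ k / (10 * (k * (6 * π / R))) / L) ≤
        (∑ p ∈ Q, f p / p) ^ r * (W ^ k / (10 * (k * (6 * π * Y)))) :=
      mul_le_mul h1 h3 (by positivity) (hμ0.le.trans h1)
    have h5 : g / L = 1 / 4 * (μ * (W₀ ^ k / (10 * (k * (6 * π / R))) / L)) := by rw [hg]; ring
    rw [h5]
    linarith
  have hcard : Fintype.card (Fin k ⊕ Fin r) ≤ J := by simp [hJ, hrR]
  have hcard' : (Fintype.card (Fin k ⊕ Fin r) : ℝ) ≤ J := by exact_mod_cast hcard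
  have hnon := sum_not_injective_le (ι := Fin k ⊕ Fin r) (P := P) (w := fun p => f p / p)
    (η := exp (-Y)) (M := M) (fun p hp => (hw p hp).1) (exp_pos _).le (fun p hp => by
      have hp0 : (0 : ℝ) < p := by exact_mod_cast (hP p hp).pos
      refine (hw p hp).2.trans ?_
      rw [exp_neg, one_div]
      gcongr
      rw [← le_log_iff_exp_le hp0]
      exact (hlog p hp).1) hM1 hWM
  have hnon2 : ∑ t ∈ Fintype.piFinset (fun _ : Fin k ⊕ Fin r => P) with ¬ Function.Injective t,
      ∏ i, f (t i) / t i ≤ g / 2 / L := by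
    refine hnon.trans ?_
    have h1 : exp (-Y) ≤ 2 / Y ^ 2 := by
      rw [exp_neg, inv_le_comm₀ (exp_pos _) (by positivity), inv_div]
      have := quadratic_le_exp_of_nonneg (show 0 ≤ Y by linarith)
      linarith
    calc _ ≤ (J : ℝ) ^ 2 * (2 / Y ^ 2 * M ^ (J + 1)) := by gcongr
      _ = 4 * (J : ℝ) ^ 2 * M ^ (J + 1) * R ^ 2 / g * (g / (2 * L ^ 2)) := by
        rw [hY]; field_simp; norm_num
      _ ≤ L * (g / (2 * L ^ 2)) := by gcongr
      _ = _ := by field_simp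
  have hsplit := Finset.sum_filter_add_sum_filter_not G Function.Injective
    (fun t => ∏ i, f (t i) / t i)
  have hsub : ∑ t ∈ G with ¬ Function.Injective t, ∏ i, f (t i) / t i ≤
      ∑ t ∈ Fintype.piFinset (fun _ : Fin k ⊕ Fin r => P) with ¬ Function.Injective t,
      ∏ i, f (t i) / t i := by
    refine Finset.sum_le_sum_of_subset_of_nonneg
      (Finset.filter_subset_filter _ (Finset.filter_subset _ _)) fun t ht _ => ?_
    have ht' := Fintype.mem_piFinset.1 (Finset.mem_filter.1 ht).1
    exact Finset.prod_nonneg fun i _ => (hw _ (ht' i)).1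
  have hmem : ∀ t ∈ G.filter Function.Injective, (∀ i, t i ∈ P) ∧ Function.Injective t ∧
      |∑ i, log (t i) - V| ≤ 1 / 3 := by
    intro t ht
    simp only [hG, Finset.mem_filter, Fintype.mem_piFinset] at ht
    refine ⟨ht.1.1, ht.2, ?_⟩
    have h1 := ht.1.2
    rw [← Finset.mul_sum, ← mul_sub, abs_mul, abs_of_pos (by positivity)] at h1
    have h2 : 6 * π * |∑ i, log (t i) - V| ≤ 6 * π * (1 / 3) := by linarith
    exact le_of_mul_le_mul_left h2 (by positivity)
  have hfin := sum_injective_tuples_le (P := P) (f := f) hP (fun n => (hf n).1) hf1 hmul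
    (y := V - 1 / 3) S (G.filter Function.Injective) (fun t ht => ⟨(hmem t ht).1, (hmem t ht).2.1⟩)
    (fun t ht => by linarith [(abs_le.1 (hmem t ht).2.2).1]) (fun t ht => by
      obtain ⟨h1, -, h3⟩ := hmem t ht
      have hpr : ∀ i, (t i).Prime := fun i => hP _ (h1 i)
      refine hS _ (Finset.prod_ne_zero_iff.2 fun i _ => (hpr i).ne_zero) (fun p hp hdvd => ?_) ?_
      · obtain ⟨j, -, hj⟩ := (Prime.dvd_finsetProd_iff hp.prime _).1 hdvd
        rw [(Nat.prime_dvd_prime_iff_eq hp (hpr j)).1 hj]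
        exact h1 j
      · push_cast
        rw [log_prod fun i _ => by exact_mod_cast (hpr i).ne_zero]
        exact h3)
  have hinj : g / 2 / L ≤ ∑ t ∈ G with Function.Injective t, ∏ i, f (t i) / t i := by
    have : g / L = g / 2 / L + g / 2 / L := by ring
    linarith
  have hSf : 0 ≤ ∑ n ∈ S, f n := Finset.sum_nonneg fun n _ => (hf n).1
  have hJJ : (Fintype.card (Fin k ⊕ Fin r) : ℝ) ^ Fintype.card (Fin k ⊕ Fin r) ≤ (J : ℝ) ^ J := by
    have : Fintype.card (Fin k ⊕ Fin r) ^ Fintype.card (Fin k ⊕ Fin r) ≤ J ^ J := by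
      refine (Nat.pow_le_pow_left hcard _).trans (Nat.pow_le_pow_right ?_ hcard)
      rw [hJ, hkdef]; positivity
    exact_mod_cast this
  calc exp (-(1 / 3)) * (g / 2) / (J : ℝ) ^ J * exp V / L
      = exp (V - 1 / 3) * (g / 2 / L) / (J : ℝ) ^ J := by
        rw [sub_eq_add_neg, exp_add]; ring
    _ ≤ exp (V - 1 / 3) * (∑ t ∈ G with Function.Injective t, ∏ i, f (t i) / t i) / (J : ℝ) ^ J := by
        gcongr
    _ ≤ (J : ℝ) ^ J * (∑ n ∈ S, f n) / (J : ℝ) ^ J := by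
        exact div_le_div_of_nonneg_right (hfin.trans (mul_le_mul_of_nonneg_right hJJ hSf))
          (by positivity)
    _ = ∑ n ∈ S, f n := by field_simp

lemma sum_powerset_prod_mul_sum_le {ι : Type*} [DecidableEq ι] (B : Finset ι) (w l : ι → ℝ)
    (hw : ∀ p ∈ B, 0 ≤ w p) (hl : ∀ p ∈ B, 0 ≤ l p) :
    ∑ s ∈ B.powerset, (∏ p ∈ s, w p) * ∑ p ∈ s, l p ≤
      (∏ p ∈ B, (1 + w p)) * ∑ p ∈ B, w p * l p := by
  induction B using Finset.induction_on with
  | empty => simp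
  | insert a B ha ih =>
    have hw' : ∀ p ∈ B, 0 ≤ w p := fun p hp => hw p (Finset.mem_insert_of_mem hp)
    have hl' : ∀ p ∈ B, 0 ≤ l p := fun p hp => hl p (Finset.mem_insert_of_mem hp)
    have ih := ih hw' hl'
    have hwa := hw a (Finset.mem_insert_self _ _)
    have hla := hl a (Finset.mem_insert_self _ _)
    have hE : 0 ≤ ∏ p ∈ B, (1 + w p) := Finset.prod_nonneg fun p hp => by linarith [hw' p hp]
    rw [Finset.sum_powerset_insert ha, Finset.prod_insert ha, Finset.sum_insert ha]
    have h1 : ∑ s ∈ B.powerset, (∏ p ∈ insert a s, w p) * ∑ p ∈ insert a s, l p =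
        w a * (∑ s ∈ B.powerset, (∏ p ∈ s, w p) * ∑ p ∈ s, l p) +
          w a * l a * ∏ p ∈ B, (1 + w p) := by
      rw [Finset.prod_one_add, Finset.mul_sum, Finset.mul_sum, ← Finset.sum_add_distrib]
      refine Finset.sum_congr rfl fun s hs => ?_
      have has : a ∉ s := fun h => ha (Finset.mem_powerset.1 hs h)
      rw [Finset.prod_insert has, Finset.sum_insert has]
      ring
    rw [h1]
    have h2 := mul_le_mul_of_nonneg_left ih (show 0 ≤ 1 + w a by linarith)
    have h3 : 0 ≤ w a * (w a * l a * ∏ p ∈ B, (1 + w p)) := by positivity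
    linarith

lemma half_prod_le_sum_powerset_filter {z : ℕ} (hz : 0 < z) {w : ℕ → ℝ} {U : ℝ} (hU0 : 0 < U)
    (hw : ∀ p, 0 ≤ w p ∧ w p ≤ 1 / p) (hU : 4 * log z ≤ U) :
    (∏ p ∈ (z + 1).primesBelow, (1 + w p)) / 2 ≤
      ∑ s ∈ (z + 1).primesBelow.powerset with ∑ p ∈ s, log ((p : ℕ) : ℝ) ≤ U, ∏ p ∈ s, w p := by
  set B := (z + 1).primesBelow
  set E := ∏ p ∈ B, (1 + w p) with hE
  have hE0 : 0 ≤ E := Finset.prod_nonneg fun p _ => by linarith [(hw p).1]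
  have hsplit := Finset.sum_filter_add_sum_filter_not B.powerset
    (fun s => ∑ p ∈ s, log p ≤ U) (fun s => ∏ p ∈ s, w p)
  rw [← Finset.prod_one_add, ← hE] at hsplit
  have h1 := sum_powerset_prod_mul_sum_le B w (fun p => log p) (fun p _ => (hw p).1)
    (fun p _ => log_natCast_nonneg p)
  have h2 : ∑ p ∈ B, w p * log p ≤ 2 * log z := by
    refine le_trans (Finset.sum_le_sum fun p _ => ?_) (sum_log_div_prime_le z hz)
    calc w p * log p ≤ 1 / p * log p :=
          mul_le_mul_of_nonneg_right (hw p).2 (log_natCast_nonneg p)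
      _ = log p / p := by ring
  have h3 : U * ∑ s ∈ B.powerset with ¬ ∑ p ∈ s, log ((p : ℕ) : ℝ) ≤ U, ∏ p ∈ s, w p ≤
      ∑ s ∈ B.powerset, (∏ p ∈ s, w p) * ∑ p ∈ s, log p := by
    rw [Finset.mul_sum]
    refine (Finset.sum_le_sum fun s hs => ?_).trans
      (Finset.sum_le_sum_of_subset_of_nonneg (Finset.filter_subset _ _) fun s _ _ =>
        mul_nonneg (Finset.prod_nonneg fun p _ => (hw p).1)
          (Finset.sum_nonneg fun p _ => log_natCast_nonneg p))
    rw [mul_comm]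
    exact mul_le_mul_of_nonneg_left (not_le.1 (Finset.mem_filter.1 hs).2).le
      (Finset.prod_nonneg fun p _ => (hw p).1)
  have h4 : U * ∑ s ∈ B.powerset with ¬ ∑ p ∈ s, log ((p : ℕ) : ℝ) ≤ U, ∏ p ∈ s, w p ≤ U * (E / 2) := by
    have := mul_le_mul_of_nonneg_left (h2.trans (show 2 * log z ≤ U / 2 by linarith)) hE0
    linarith
  have h5 := le_of_mul_le_mul_left h4 hU0
  linarith

lemma map_prod_primes {f : ℕ → ℝ} (hf1 : f 1 = 1)
    (hmul : ∀ m n : ℕ, Nat.Coprime m n → f (m * n) = f m * f n) (s : Finset ℕ)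
    (hs : ∀ p ∈ s, p.Prime) : f (∏ p ∈ s, p) = ∏ p ∈ s, f p := by
  induction s using Finset.induction_on with
  | empty => simpa using hf1
  | insert a s ha ih =>
    have ha' := hs a (Finset.mem_insert_self _ _)
    have hs' : ∀ p ∈ s, p.Prime := fun p hp => hs p (Finset.mem_insert_of_mem hp)
    rw [Finset.prod_insert ha, Finset.prod_insert ha, hmul, ih hs']
    refine Nat.Coprime.prod_right fun p hp => ?_
    exact (Nat.coprime_primes ha' (hs' p hp)).2 fun h => ha (h ▸ hp)

/-- Summing over products of a squarefree `z`-smooth part and a `z`-rough part. -/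
lemma sum_smooth_mul_rough_le {f : ℕ → ℝ} (hf : ∀ n, 0 ≤ f n) (hf1 : f 1 = 1)
    (hmul : ∀ m n : ℕ, Nat.Coprime m n → f (m * n) = f m * f n) {z : ℕ} (A : Finset (Finset ℕ))
    (hA : ∀ s ∈ A, s ⊆ (z + 1).primesBelow) (S : Finset ℕ → Finset ℕ)
    (hS : ∀ s ∈ A, ∀ n ∈ S s, ∀ p, p.Prime → p ∣ n → z < p) (T : Finset ℕ)
    (hT : ∀ s ∈ A, ∀ n ∈ S s, (∏ p ∈ s, p) * n ∈ T) :
    ∑ s ∈ A, (∏ p ∈ s, f p) * ∑ n ∈ S s, f n ≤ ∑ n ∈ T, f n := by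
  have hpr : ∀ s ∈ A, ∀ p ∈ s, p.Prime := fun s hs p hp =>
    Nat.prime_of_mem_primesBelow (hA s hs hp)
  have hle : ∀ s ∈ A, ∀ p ∈ s, p ≤ z := fun s hs p hp =>
    Nat.lt_succ_iff.1 (Nat.lt_of_mem_primesBelow (hA s hs hp))
  have hco : ∀ s ∈ A, ∀ n ∈ S s, Nat.Coprime (∏ p ∈ s, p) n := by
    intro s hs n hn
    refine Nat.Coprime.prod_left fun p hp => ?_
    rw [(hpr s hs p hp).coprime_iff_not_dvd]
    exact fun h => absurd (hS s hs n hn p (hpr s hs p hp) h) (not_lt.2 (hle s hs p hp))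
  have hmem : ∀ s ∈ A, ∀ n ∈ S s, ∀ p, p ∈ s ↔ p.Prime ∧ p ≤ z ∧ p ∣ (∏ q ∈ s, q) * n := by
    intro s hs n hn p
    refine ⟨fun hp => ⟨hpr s hs p hp, hle s hs p hp, (Finset.dvd_prod_of_mem _ hp).mul_right _⟩,
      fun ⟨hp, hpz, hd⟩ => ?_⟩
    rcases hp.dvd_mul.1 hd with h | h
    · obtain ⟨q, hq, hpq⟩ := (Prime.dvd_finsetProd_iff hp.prime _).1 h
      rwa [(Nat.prime_dvd_prime_iff_eq hp (hpr s hs q hq)).1 hpq]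
    · exact absurd (hS s hs n hn p hp h) (not_lt.2 hpz)
  have hinj : Set.InjOn (fun x : (_ : Finset ℕ) × ℕ => (∏ p ∈ x.1, p) * x.2) (A.sigma S) := by
    rintro ⟨s, n⟩ hx ⟨t, m⟩ hy hxy
    obtain ⟨hs, hn⟩ := Finset.mem_sigma.1 (Finset.mem_coe.1 hx)
    obtain ⟨ht, hm⟩ := Finset.mem_sigma.1 (Finset.mem_coe.1 hy)
    dsimp only at hs hn ht hm hxy
    obtain rfl : s = t := by
      ext p
      rw [hmem s hs n hn, hmem t ht m hm, hxy]
    have h0 : 0 < ∏ p ∈ s, p := Finset.prod_pos fun p hp => (hpr s hs p hp).pos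
    rw [Nat.eq_of_mul_eq_mul_left h0 hxy]
  calc ∑ s ∈ A, (∏ p ∈ s, f p) * ∑ n ∈ S s, f n
      = ∑ s ∈ A, ∑ n ∈ S s, f ((∏ p ∈ s, p) * n) := by
        refine Finset.sum_congr rfl fun s hs => ?_
        rw [Finset.mul_sum]
        refine Finset.sum_congr rfl fun n hn => ?_
        rw [hmul _ _ (hco s hs n hn), map_prod_primes hf1 hmul s (hpr s hs)]
    _ = ∑ n ∈ (A.sigma S).image fun x => (∏ p ∈ x.1, p) * x.2, f n := by
        rw [Finset.sum_image hinj, Finset.sum_sigma]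
    _ ≤ ∑ n ∈ T, f n := by
        refine Finset.sum_le_sum_of_subset_of_nonneg (fun n hn => ?_) fun n _ _ => hf n
        obtain ⟨⟨s, m⟩, hx, rfl⟩ := Finset.mem_image.1 hn
        obtain ⟨hs, hm⟩ := Finset.mem_sigma.1 hx
        exact hT s hs m hm

lemma prod_one_add_sub_one_div_mul_le {f : ℕ → ℝ} (hf : ∀ n, f n ∈ Set.Icc (0 : ℝ) 1)
    {z N : ℕ} (hzN : z ≤ N) :
    (∏ p ∈ (N + 1).primesBelow, (1 + (f p - 1) / p)) *
        ∏ p ∈ (z + 1).primesBelow, (1 + (1 : ℝ) / p) ≤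
      ∏ p ∈ (z + 1).primesBelow, (1 + f p / p) := by
  have h0 : ∀ p ∈ (N + 1).primesBelow, 0 ≤ 1 + (f p - 1) / p ∧ 1 + (f p - 1) / p ≤ 1 := by
    intro p hp
    have hp1 : (1 : ℝ) ≤ p := by exact_mod_cast (Nat.prime_of_mem_primesBelow hp).one_le
    have := hf p
    constructor
    · have : -1 ≤ (f p - 1) / p := by rw [le_div_iff₀ (by linarith)]; linarith [this.1]
      linarith
    · have : (f p - 1) / p ≤ 0 := div_nonpos_of_nonpos_of_nonneg (by linarith [this.2]) (by linarith)
      linarith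
  have hsub : (z + 1).primesBelow ⊆ (N + 1).primesBelow := by
    intro p hp
    rw [Nat.mem_primesBelow] at hp ⊢
    exact ⟨by omega, hp.2⟩
  have h1 : ∏ p ∈ (N + 1).primesBelow, (1 + (f p - 1) / p) ≤
      ∏ p ∈ (z + 1).primesBelow, (1 + (f p - 1) / p) := by
    rw [← Finset.prod_sdiff hsub]
    refine mul_le_of_le_one_left (Finset.prod_nonneg fun p hp => (h0 p (hsub hp)).1) ?_
    exact Finset.prod_le_one (fun p hp => (h0 p (Finset.mem_sdiff.1 hp).1).1)
      (fun p hp => (h0 p (Finset.mem_sdiff.1 hp).1).2)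
  refine (mul_le_mul_of_nonneg_right h1 (Finset.prod_nonneg fun p _ => by positivity)).trans ?_
  rw [← Finset.prod_mul_distrib]
  refine Finset.prod_le_prod (fun p hp => mul_nonneg (h0 p (hsub hp)).1 (by positivity))
    fun p hp => ?_
  have hp0 : (0 : ℝ) < p := by exact_mod_cast (Nat.prime_of_mem_primesBelow hp).pos
  have : (1 + (f p - 1) / p) * (1 + 1 / p) = 1 + f p / p - (1 - f p) / p ^ 2 := by
    field_simp; ring
  rw [this]
  have : 0 ≤ (1 - f p) / (p : ℝ) ^ 2 := div_nonneg (by linarith [(hf p).2]) (by positivity)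
  linarith

set_option maxHeartbeats 800000 in
/-- The lower bound for the mean value when a single dyadic scale carries enough mass. -/
lemma exists_mean_ge_of_scale : ∃ C₁ : ℝ, 0 < C₁ ∧ ∀ (i : ℕ) (W₀ : ℝ), 0 < W₀ →
    C₁ ≤ 2 ^ i * W₀ ^ 12 → ∃ c : ℝ, 0 < c ∧ ∃ X₀ : ℝ, ∀ X, X₀ ≤ X →
      ∀ f : ℕ → ℝ, (∀ n, f n ∈ Set.Icc (0 : ℝ) 1) → f 1 = 1 →
      (∀ m n : ℕ, Nat.Coprime m n → f (m * n) = f m * f n) →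
      ∀ P : Finset ℕ, (∀ p ∈ P, p.Prime) →
      (∀ p ∈ P, log X / 2 ^ (i + 3) < log p ∧ log p ≤ 2 * (log X / 2 ^ (i + 3))) →
      W₀ ≤ ∑ p ∈ P, f p / p →
      c * ∏ p ∈ (⌊X⌋₊ + 1).primesBelow, (1 + (f p - 1) / p)
        ≤ (1 / X) * ∑ n ∈ Finset.Ioc ⌊X⌋₊ ⌊2 * X⌋₊, f n := by
  obtain ⟨C₁, hC₁, hrough⟩ := exists_sum_rough_ge
  obtain ⟨c', hc', hmert⟩ := exists_prod_one_add_inv_ge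
  refine ⟨C₁, hC₁, fun i W₀ hW₀ hk => ?_⟩
  obtain ⟨c, hc, L₀, hL₀, hrough⟩ := hrough i W₀ hW₀ hk
  refine ⟨c * c' / (2 * 2 ^ (i + 3)), by positivity, exp L₀,
    fun X hX f hf hf1 hmul P hP hlog hW => ?_⟩
  have hX0 : 0 < X := (exp_pos _).trans_le hX
  set L := log X with hL
  have hLL : L₀ ≤ L := (le_log_iff_exp_le hX0).2 hX
  have hL0 : 0 < L := hL₀.trans_le hLL
  set R : ℝ := 2 ^ (i + 3) with hR
  have hR8 : 8 ≤ R := by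
    rw [hR, pow_add]
    have : (1 : ℝ) ≤ 2 ^ i := one_le_pow₀ (by norm_num)
    linarith
  set Y := L / R with hY
  have hY0 : 0 < Y := by positivity
  have hY8 : Y ≤ L / 8 := by rw [hY]; gcongr
  set z := ⌊exp Y⌋₊ with hz
  have hz1 : 1 ≤ z := by
    rw [hz, Nat.one_le_floor_iff]
    exact one_le_exp hY0.le
  have hzle : (z : ℝ) ≤ exp Y := Nat.floor_le (exp_pos _).le
  have hzlog : log z ≤ Y := by
    rw [log_le_iff_le_exp (by exact_mod_cast hz1)]; exact hzle
  have hzlog' : Y ≤ log (z + 1) := by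
    rw [le_log_iff_exp_le (by positivity)]; exact (Nat.lt_floor_add_one _).le
  have hzX : z ≤ ⌊X⌋₊ := by
    apply Nat.floor_le_floor
    rw [← le_log_iff_exp_le hX0]
    linarith
  have hPz : ∀ p ∈ P, z < p := by
    intro p hp
    have hp0 : (0 : ℝ) < p := by exact_mod_cast (hP p hp).pos
    have := (lt_log_iff_exp_lt hp0).1 (hlog p hp).1
    exact_mod_cast hzle.trans_lt this
  have hlog2 : 0.6931471803 < log 2 := log_two_gt_d9
  have hlog2' : log 2 < 0.6931471808 := log_two_lt_d9
  set A := (z + 1).primesBelow.powerset.filter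
    fun s : Finset ℕ => ∑ p ∈ s, log (p : ℝ) ≤ L / 2 with hA
  set v : Finset ℕ → ℝ := fun s => L - ∑ p ∈ s, log (p : ℝ) + log 2 / 2 with hv
  set S : Finset ℕ → Finset ℕ := fun s => by
    classical
    exact (Finset.Icc 1 ⌊2 * X⌋₊).filter fun n =>
      (∀ p, p.Prime → p ∣ n → p ∈ P) ∧ |log n - v s| ≤ 1 / 3 with hS
  have hSmem : ∀ s n, n ∈ S s ↔ (1 ≤ n ∧ n ≤ ⌊2 * X⌋₊) ∧ (∀ p, p.Prime → p ∣ n → p ∈ P) ∧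
      |log n - v s| ≤ 1 / 3 := fun s n => by simp [hS]
  have hApr : ∀ s ∈ A, ∀ p ∈ s, p.Prime := fun s hs p hp =>
    Nat.prime_of_mem_primesBelow (Finset.mem_powerset.1 (Finset.mem_filter.1 hs).1 hp)
  have hl0 : ∀ s : Finset ℕ, 0 ≤ ∑ p ∈ s, log (p : ℝ) := fun s =>
    Finset.sum_nonneg fun p _ => log_natCast_nonneg p
  have hSge : ∀ s ∈ A, c * exp (v s) / L ≤ ∑ n ∈ S s, f n := by
    intro s hs
    have h1 := (Finset.mem_filter.1 hs).2
    refine hrough L hLL f hf hf1 hmul P hP (fun p hp => ⟨(hlog p hp).1.le, (hlog p hp).2⟩) hW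
      (v s) (by simp only [hv]; linarith) (by simp only [hv]; linarith [hl0 s]) (S s)
      fun n hn hnP hnv => (hSmem s n).2 ⟨⟨Nat.one_le_iff_ne_zero.2 hn, ?_⟩, hnP, hnv⟩
    have hn0 : (0 : ℝ) < n := by exact_mod_cast Nat.pos_of_ne_zero hn
    apply Nat.le_floor
    rw [← log_le_log_iff hn0 (by positivity), log_mul (by norm_num) hX0.ne']
    have := (abs_le.1 hnv).2
    simp only [hv] at this
    linarith [hl0 s]
  have hmain := sum_smooth_mul_rough_le (fun n => (hf n).1) hf1 hmul (z := z) A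
    (fun s hs => Finset.mem_powerset.1 (Finset.mem_filter.1 hs).1) S
    (fun s hs n hn p hp hd => hPz p (((hSmem s n).1 hn).2.1 p hp hd))
    (Finset.Ioc ⌊X⌋₊ ⌊2 * X⌋₊) (by
      intro s hs n hn
      obtain ⟨⟨hn1, -⟩, -, hn3⟩ := (hSmem s n).1 hn
      have hm0 : (0 : ℝ) < ∏ p ∈ s, (p : ℝ) :=
        Finset.prod_pos fun p hp => by exact_mod_cast (hApr s hs p hp).pos
      have hn0 : (0 : ℝ) < n := by exact_mod_cast hn1
      have hlg : log ((∏ p ∈ s, (p : ℝ)) * n) = ∑ p ∈ s, log (p : ℝ) + log n := by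
        rw [log_mul hm0.ne' hn0.ne', log_prod fun p hp => by
          exact_mod_cast (hApr s hs p hp).ne_zero]
      have h3 := abs_le.1 hn3
      simp only [hv] at h3
      rw [Finset.mem_Ioc]
      constructor
      · rw [Nat.floor_lt hX0.le]
        push_cast
        rw [← log_lt_log_iff hX0 (by positivity), hlg]
        linarith [h3.1]
      · apply Nat.le_floor
        push_cast
        rw [← log_le_log_iff (by positivity) (by positivity), hlg, log_mul (by norm_num) hX0.ne']
        linarith [h3.2])
  have hw : ∀ p : ℕ, 0 ≤ f p / p ∧ f p / p ≤ 1 / p := fun p =>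
    ⟨div_nonneg (hf p).1 (Nat.cast_nonneg _),
      div_le_div_of_nonneg_right (hf p).2 (Nat.cast_nonneg _)⟩
  have hhalf := half_prod_le_sum_powerset_filter (z := z) (by omega) (w := fun p => f p / p)
    (U := L / 2) (by positivity) hw (by linarith)
  set E := ∏ p ∈ (z + 1).primesBelow, (1 + f p / p) with hE
  have hlow : c * X / L * (E / 2) ≤ ∑ n ∈ Finset.Ioc ⌊X⌋₊ ⌊2 * X⌋₊, f n := by
    refine le_trans ?_ hmain
    refine (mul_le_mul_of_nonneg_left hhalf (by positivity)).trans ?_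
    rw [Finset.mul_sum]
    refine Finset.sum_le_sum fun s hs => ?_
    have hfs : 0 ≤ ∏ p ∈ s, f p := Finset.prod_nonneg fun p _ => (hf p).1
    have hm0 : (0 : ℝ) < ∏ p ∈ s, (p : ℝ) :=
      Finset.prod_pos fun p hp => by exact_mod_cast (hApr s hs p hp).pos
    refine le_trans ?_ (mul_le_mul_of_nonneg_left (hSge s hs) hfs)
    have h1 : X / ∏ p ∈ s, (p : ℝ) ≤ exp (v s) := by
      rw [← log_le_iff_le_exp (by positivity), log_div hX0.ne' hm0.ne', log_prod fun p hp => by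
          exact_mod_cast (hApr s hs p hp).ne_zero]
      simp only [hv]
      linarith
    rw [Finset.prod_div_distrib]
    calc _ = (∏ p ∈ s, f p) * (c * (X / ∏ p ∈ s, (p : ℝ)) / L) := by ring
      _ ≤ _ := by gcongr
  have hcmp := prod_one_add_sub_one_div_mul_le hf hzX
  set D := ∏ p ∈ (⌊X⌋₊ + 1).primesBelow, (1 + (f p - 1) / p) with hD
  have hD0 : 0 ≤ D := Finset.prod_nonneg fun p hp => by
    have hp1 : (1 : ℝ) ≤ p := by exact_mod_cast (Nat.prime_of_mem_primesBelow hp).one_le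
    have : -1 ≤ (f p - 1) / p := by rw [le_div_iff₀ (by linarith)]; linarith [(hf p).1]
    linarith
  have hDE : D * (c' * Y) ≤ E :=
    (mul_le_mul_of_nonneg_left ((mul_le_mul_of_nonneg_left hzlog' hc'.le).trans (hmert z))
      hD0).trans hcmp
  calc c * c' / (2 * R) * D = c / (2 * L) * (D * (c' * Y)) := by rw [hY]; field_simp
    _ ≤ c / (2 * L) * E := by gcongr
    _ = 1 / X * (c * X / L * (E / 2)) := by field_simp
    _ ≤ _ := by gcongr

lemma exists_dyadic_scale {L δ t : ℝ} (hL : 0 < L) {I : ℕ} (hI : 1 / 2 ^ (I + 3) ≤ δ)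
    (ht1 : δ * L < t) (ht2 : t ≤ L / 4) :
    ∃ i ∈ Finset.range (I + 1), L / 2 ^ (i + 3) < t ∧ t ≤ 2 * (L / 2 ^ (i + 3)) := by
  classical
  have hex : ∃ i : ℕ, L / 2 ^ (i + 3) < t := ⟨I, by
    refine lt_of_le_of_lt ?_ ht1
    rw [div_eq_mul_one_div, mul_comm]
    gcongr⟩
  have hle : Nat.find hex ≤ I := Nat.find_min' hex (by
    refine lt_of_le_of_lt ?_ ht1
    rw [div_eq_mul_one_div, mul_comm]
    gcongr)
  refine ⟨Nat.find hex, Finset.mem_range.2 (Nat.lt_succ_of_le hle), Nat.find_spec hex, ?_⟩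
  rcases h : Nat.find hex with _ | j
  · norm_num
    linarith
  · have h1 := not_lt.1 (Nat.find_min hex (m := j) (by omega))
    refine h1.trans (le_of_eq ?_)
    rw [show j + 1 + 3 = j + 3 + 1 by ring, pow_succ (2 : ℝ) (j + 3)]
    field_simp

lemma sum_le_sum_range_filter {F : Finset ℕ} {w : ℕ → ℝ} (hw : ∀ p ∈ F, 0 ≤ w p) {N : ℕ}
    (q : ℕ → ℕ → Prop) [∀ i, DecidablePred (q i)]
    (hq : ∀ p ∈ F, ∃ i ∈ Finset.range N, q i p) :
    ∑ p ∈ F, w p ≤ ∑ i ∈ Finset.range N, ∑ p ∈ F with q i p, w p := by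
  simp_rw [Finset.sum_filter]
  rw [Finset.sum_comm]
  refine Finset.sum_le_sum fun p hp => ?_
  obtain ⟨i, hi, hqi⟩ := hq p hp
  refine le_trans (le_of_eq (if_pos hqi).symm)
    (Finset.single_le_sum (f := fun j => if q j p then w p else 0) (fun j _ => ?_) hi)
  split_ifs
  exacts [hw p hp, le_rfl]

end

theorem stmt_18 :
    ∃ lam : ℝ, 0 < lam ∧
      ∀ δ : ℝ, 0 < δ →
      ∃ c : ℝ, 0 < c ∧
      ∃ X₀ : ℝ, ∀ X : ℝ, X₀ ≤ X →
      ∀ f : ℕ → ℝ, (∀ n, f n ∈ Set.Icc (0 : ℝ) 1) → f 1 = 1 →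
        (∀ m n : ℕ, Nat.Coprime m n → f (m * n) = f m * f n) →
        lam ≤ (∑ p ∈ (Finset.range (⌊X ^ ((1 : ℝ) / 4)⌋₊ + 1)).filter
            (fun p : ℕ => p.Prime ∧ X ^ δ < (p : ℝ)), f p / p) →
        c * ∏ p ∈ (Finset.range (⌊X⌋₊ + 1)).filter Nat.Prime, (1 + (f p - 1) / p)
          ≤ (1 / X) * ∑ n ∈ Finset.Ioc ⌊X⌋₊ ⌊2 * X⌋₊, f n := by
  obtain ⟨C₁, hC₁, hscale⟩ := exists_mean_ge_of_scale
  obtain ⟨ρ, hρ⟩ : ∃ ρ : ℝ, ρ = (1 / 2 : ℝ) ^ ((1 : ℝ) / 12) := ⟨_, rfl⟩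
  have hρ0 : 0 < ρ := by rw [hρ]; positivity
  have hρ1 : ρ < 1 := by rw [hρ]; exact Real.rpow_lt_one (by norm_num) (by norm_num) (by norm_num)
  have hρ12 : ρ ^ 12 = 1 / 2 := by
    rw [hρ, ← Real.rpow_natCast, ← Real.rpow_mul (by norm_num)]
    norm_num
  set C₀ := max 1 C₁ with hC₀
  have hC₀1 : 1 ≤ C₀ := le_max_left _ _
  refine ⟨C₀ / (1 - ρ), div_pos (by linarith) (by linarith), fun δ hδ => ?_⟩
  obtain ⟨I, hI⟩ : ∃ I : ℕ, (1 : ℝ) / 2 ^ (I + 3) ≤ δ := by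
    obtain ⟨n, hn⟩ := exists_pow_lt_of_lt_one hδ (show (1 / 2 : ℝ) < 1 by norm_num)
    refine ⟨n, le_trans ?_ hn.le⟩
    rw [div_pow, one_pow]
    gcongr <;> norm_num
  have hmass : ∀ i : ℕ, C₁ ≤ 2 ^ i * (C₀ * ρ ^ i) ^ 12 := by
    intro i
    have : (2 : ℝ) ^ i * (C₀ * ρ ^ i) ^ 12 = C₀ ^ 12 := by
      rw [mul_pow, ← pow_mul, mul_comm i 12, pow_mul, hρ12, mul_left_comm, ← mul_pow]
      norm_num
    rw [this]
    exact (le_max_right _ _).trans (le_self_pow₀ hC₀1 (by norm_num))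
  choose c hc X₀ hX₀ using fun i : ℕ => hscale i (C₀ * ρ ^ i) (by positivity) (hmass i)
  refine ⟨(Finset.range (I + 1)).inf' (by simp) c, by simp [Finset.lt_inf'_iff, hc],
    max 2 ((Finset.range (I + 1)).sup' (by simp) X₀), fun X hX f hf hf1 hmul hsum => ?_⟩
  have hX2 : 2 ≤ X := (le_max_left _ _).trans hX
  have hX0 : 0 < X := by linarith
  have hL : 0 < Real.log X := Real.log_pos (by linarith)
  set F := (Finset.range (⌊X ^ ((1 : ℝ) / 4)⌋₊ + 1)).filter
    (fun p : ℕ => p.Prime ∧ X ^ δ < (p : ℝ)) with hF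
  have hFp : ∀ p ∈ F, p.Prime := fun p hp => (Finset.mem_filter.1 hp).2.1
  have hFlog : ∀ p ∈ F, δ * Real.log X < Real.log p ∧ Real.log p ≤ Real.log X / 4 := by
    intro p hp
    obtain ⟨h1, hp', h2⟩ := Finset.mem_filter.1 hp
    have hp0 : (0 : ℝ) < p := by exact_mod_cast hp'.pos
    have h3 : (p : ℝ) ≤ X ^ ((1 : ℝ) / 4) :=
      (Nat.le_floor_iff (by positivity)).1 (Nat.lt_succ_iff.1 (Finset.mem_range.1 h1))
    constructor
    · rw [← Real.log_rpow hX0]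
      exact Real.log_lt_log (by positivity) h2
    · have := Real.log_le_log hp0 h3
      rw [Real.log_rpow hX0] at this
      linarith
  obtain ⟨i, hi, hWi⟩ : ∃ i ∈ Finset.range (I + 1), C₀ * ρ ^ i ≤
      ∑ p ∈ F with Real.log X / 2 ^ (i + 3) < Real.log (p : ℕ) ∧
        Real.log (p : ℕ) ≤ 2 * (Real.log X / 2 ^ (i + 3)), f p / p := by
    by_contra! hcon
    have h1 := sum_le_sum_range_filter (F := F) (w := fun p => f p / p) (N := I + 1)
      (fun p _ => div_nonneg (hf p).1 (Nat.cast_nonneg _))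
      (fun i p => Real.log X / 2 ^ (i + 3) < Real.log (p : ℕ) ∧
        Real.log (p : ℕ) ≤ 2 * (Real.log X / 2 ^ (i + 3)))
      (fun p hp => exists_dyadic_scale hL hI (hFlog p hp).1 (hFlog p hp).2)
    have h2 := Finset.sum_lt_sum_of_nonempty (by simp) hcon
    have h3 : ∑ i ∈ Finset.range (I + 1), C₀ * ρ ^ i ≤ C₀ / (1 - ρ) := by
      rw [← Finset.mul_sum, div_eq_mul_inv, ← tsum_geometric_of_lt_one hρ0.le hρ1]
      gcongr
      exact (summable_geometric_of_lt_one hρ0.le hρ1).sum_le_tsum _ fun _ _ => by positivity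
    linarith
  have hXi : X₀ i ≤ X := (Finset.le_sup' X₀ hi).trans ((le_max_right _ _).trans hX)
  have key := hX₀ i X hXi f hf hf1 hmul _ (fun p hp => hFp p (Finset.mem_filter.1 hp).1)
    (fun p hp => (Finset.mem_filter.1 hp).2) hWi
  refine le_trans (mul_le_mul_of_nonneg_right (Finset.inf'_le c hi)
    (Finset.prod_nonneg fun p hp => ?_)) key
  have hp1 : (1 : ℝ) ≤ p := by exact_mod_cast (Finset.mem_filter.1 hp).2.one_le
  have : -1 ≤ (f p - 1) / p := by rw [le_div_iff₀ (by linarith)]; linarith [(hf p).1]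
  linarith
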